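/- arXiv:1012.3313 — 3 statements merged into one kernel-verified Lean document; each statement's English description precedes it below -/
import Mathlib

section
/- For every β ≥ 0 and h ∈ ℝ, the averaged quenched free energy converges: E^{(N)}[F_N(β,h,ω)] → G(β,h) as N → ∞, where G(β,h) := 0 if h ≤ −β; G(β,h) := F(h+β)/2 if −β < h < β; and G(β,h) := (F(h+β) + F(h−β))/2 if h ≥ β. -/
open Filter Topology

/-- The contact point `t_i = s_1 + ⋯ + s_i` associated to interarrival times
`s : Fin k → {0,…,N}`. -/
def contacts {k N : ℕ} (s : Fin k → Fin (N + 1)) (i : Fin k) : ℕ :=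
  ∑ j ∈ Finset.univ.filter (fun j => j ≤ i), (s j : ℕ)

/-- The constrained homogeneous partition function `Z_{N,u}` (with `Z_{0,u} = 1`). -/
noncomputable def Zhom (K : ℕ → ℝ) (u : ℝ) (N : ℕ) : ℝ :=
  if N = 0 then 1 else
    ∑ k ∈ Finset.Icc 1 N, ∑ s : Fin k → Fin (N + 1),
      if (∀ i, 1 ≤ (s i : ℕ)) ∧ (∑ i, (s i : ℕ)) = N then
        Real.exp ((k : ℝ) * u) * ∏ i, K (s i : ℕ)
      else 0

/-- The quenched partition function `Z_{N,β,h,ω}`. -/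
noncomputable def Zq (K : ℕ → ℝ) (β h : ℝ) (ω : ℕ → ℝ) (N : ℕ) : ℝ :=
  ∑ k ∈ Finset.Icc 1 N, ∑ s : Fin k → Fin (N + 1),
    if (∀ i, 1 ≤ (s i : ℕ)) ∧ (∑ i, (s i : ℕ)) = N then
      Real.exp (∑ i : Fin k, (β * ω (contacts s i) + h)) * ∏ i, K (s i : ℕ)
    else 0

/-- The set of sign-change positions `m ∈ {2,…,N+1}` of `ω` (i.e. `ω_m ≠ ω_{m-1}`):
the strip endpoints `L_1 < ⋯ < L_{B_N}` are exactly these positions minus one. -/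
noncomputable def changeSet (ω : ℕ → ℝ) (N : ℕ) : Finset ℕ :=
  (Finset.Icc 2 (N + 1)).filter fun m => ω m ≠ ω (m - 1)

/-- `B_N`, the number of complete strips between `0` and `N`. -/
noncomputable def BN (ω : ℕ → ℝ) (N : ℕ) : ℕ := (changeSet ω N).card

/-- The strip endpoints: `L_0 = 0` and, for `1 ≤ k ≤ B_N`, `L_k` is the `k`-th
sign-change position of `ω` minus one. -/
noncomputable def Lstrip (ω : ℕ → ℝ) (N : ℕ) (k : ℕ) : ℕ :=
  if k = 0 then 0 else ((changeSet ω N).sort (· ≤ ·)).getD (k - 1) 0 - 1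

/-- The constrained partition function `Z^c_{N,β,h,ω}`: the sum is restricted to
contact sets containing each of the strip endpoints `L_1, …, L_{B_N}`. -/
noncomputable def Zc (K : ℕ → ℝ) (β h : ℝ) (ω : ℕ → ℝ) (N : ℕ) : ℝ :=
  ∑ k ∈ Finset.Icc 1 N, ∑ s : Fin k → Fin (N + 1),
    if (∀ i, 1 ≤ (s i : ℕ)) ∧ (∑ i, (s i : ℕ)) = N ∧
        (∀ m ∈ changeSet ω N, ∃ i : Fin k, contacts s i = m - 1) then
      Real.exp (∑ i : Fin k, (β * ω (contacts s i) + h)) * ∏ i, K (s i : ℕ)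
    else 0

/-- The probability, under the stationary `{-1,+1}`-valued Markov chain `P^{(N)}`
with flip probability `N^{-γ}`, of the trajectory `w` on `{0,…,N+1}`. -/
noncomputable def pathProb (γ : ℝ) (N : ℕ) (w : Fin (N + 2) → Bool) : ℝ :=
  (1 / 2) * ∏ i : Fin (N + 1),
    if w i.castSucc = w i.succ then 1 - (N : ℝ) ^ (-γ) else (N : ℝ) ^ (-γ)

/-- The `±1`-valued sequence associated to a trajectory `w` on `{0,…,N+1}`
(extended constantly beyond `N+1`; the partition functions at size `N` only
depend on the first `N+2` values). -/
noncomputable def omegaOf (N : ℕ) (w : Fin (N + 2) → Bool) (n : ℕ) : ℝ :=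
  if hn : n < N + 2 then (if w ⟨n, hn⟩ then 1 else -1)
  else (if w (Fin.last (N + 1)) then 1 else -1)

/-- The limiting free energy of model B:
`G(β,h) = 0` if `h ≤ -β`, `F(h+β)/2` if `-β < h < β`, and
`(F(h+β) + F(h-β))/2` if `h ≥ β`. -/
noncomputable def Gfun (F : ℝ → ℝ) (β h : ℝ) : ℝ :=
  if h ≤ -β then 0 else if h < β then F (h + β) / 2 else (F (h + β) + F (h - β)) / 2

/-- Partition function with exactly `k` contacts, by recursion on the last jump. -/
noncomputable def Yk (K : ℕ → ℝ) (u : ℕ → ℝ) : ℕ → ℕ → ℝ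
  | 0, n => if n = 0 then 1 else 0
  | k + 1, n => ∑ m ∈ Finset.range n, Yk K u k m * (K (n - m) * Real.exp (u n))

/-- Partition function with site-dependent energies `u`. -/
noncomputable def YY (K : ℕ → ℝ) (u : ℕ → ℝ) (n : ℕ) : ℝ :=
  ∑ k ∈ Finset.range (n + 1), Yk K u k n

lemma Yk_zero_of_lt (K : ℕ → ℝ) (u : ℕ → ℝ) : ∀ k n : ℕ, n < k → Yk K u k n = 0 := by
  intro k
  induction k with
  | zero => intro n hn; omega
  | succ k ih =>
    intro n hn
    rw [Yk]
    apply Finset.sum_eq_zero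
    intro m hm
    rw [Finset.mem_range] at hm
    rw [ih m (by omega), zero_mul]

lemma YY_eq_of_le (K : ℕ → ℝ) (u : ℕ → ℝ) (n R : ℕ) (h : n + 1 ≤ R) :
    ∑ k ∈ Finset.range R, Yk K u k n = YY K u n := by
  unfold YY
  symm
  apply Finset.sum_subset
  · intro x hx; simp only [Finset.mem_range] at *; omega
  · intro x hx hx'
    simp only [Finset.mem_range] at *
    exact Yk_zero_of_lt K u x n (by omega)

lemma YY_zero (K : ℕ → ℝ) (u : ℕ → ℝ) : YY K u 0 = 1 := by
  simp [YY, Yk]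

lemma YY_rec (K : ℕ → ℝ) (u : ℕ → ℝ) (n : ℕ) (hn : 1 ≤ n) :
    YY K u n = ∑ m ∈ Finset.range n, YY K u m * (K (n - m) * Real.exp (u n)) := by
  unfold YY
  rw [Finset.sum_range_succ']
  have h0 : Yk K u 0 n = 0 := by rw [Yk]; simp; omega
  rw [h0, add_zero]
  simp only [Yk]
  rw [Finset.sum_comm]
  apply Finset.sum_congr rfl
  intro m hm
  rw [Finset.mem_range] at hm
  rw [← Finset.sum_mul, YY_eq_of_le K u m n (by omega)]
  rfl

lemma sum_reflect_aux (M n : ℕ) (hn : n ≤ M) (G : ℕ → ℝ) :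
    ∑ j : Fin (M + 1), (if 1 ≤ (j : ℕ) ∧ (j : ℕ) ≤ n then G j else 0) =
      ∑ m ∈ Finset.range n, G (n - m) := by
  rw [Fin.sum_univ_eq_sum_range (fun j => if 1 ≤ j ∧ j ≤ n then G j else 0) (M + 1)]
  rw [← Finset.sum_filter]
  apply Finset.sum_nbij' (fun j => n - j) (fun m => n - m)
  · intro a ha; simp at *; omega
  · intro a ha; simp at *; omega
  · intro a ha; simp at *; omega
  · intro a ha; simp at *; omega
  · intro a ha; simp at *; congr 1; omega

lemma contacts_snoc_castSucc {k M : ℕ} (s : Fin k → Fin (M + 1)) (j : Fin (M + 1)) (i : Fin k) :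
    contacts (Fin.snoc (α := fun _ => Fin (M + 1)) s j) i.castSucc = contacts s i := by
  unfold contacts
  rw [Finset.sum_filter, Finset.sum_filter, Fin.sum_univ_castSucc]
  simp

lemma contacts_snoc_last {k M : ℕ} (s : Fin k → Fin (M + 1)) (j : Fin (M + 1)) :
    contacts (Fin.snoc (α := fun _ => Fin (M + 1)) s j) (Fin.last k) = ∑ i, (s i : ℕ) + j := by
  unfold contacts
  rw [Finset.sum_filter, Fin.sum_univ_castSucc]
  simp [Fin.le_last]

lemma bridge (K : ℕ → ℝ) (u : ℕ → ℝ) (M : ℕ) : ∀ k n : ℕ, n ≤ M →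
    (∑ s : Fin k → Fin (M + 1),
      if (∀ i, 1 ≤ (s i : ℕ)) ∧ (∑ i, (s i : ℕ)) = n then
        Real.exp (∑ i : Fin k, u (contacts s i)) * ∏ i, K (s i : ℕ)
      else 0) = Yk K u k n := by
  intro k
  induction k with
  | zero =>
    intro n hn
    simp [Yk, eq_comm]
  | succ k ih =>
    intro n hn
    rw [Yk, ← (Fin.snocEquiv (fun _ : Fin (k + 1) => Fin (M + 1))).sum_comp,
      Fintype.sum_prod_type]
    have := sum_reflect_aux M n hn (fun j => Yk K u k (n - j) * (K j * Real.exp (u n)))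
    have h2 : ∑ m ∈ Finset.range n, Yk K u k m * (K (n - m) * Real.exp (u n)) =
      ∑ m ∈ Finset.range n, (fun j => Yk K u k (n - j) * (K j * Real.exp (u n))) (n - m) := by
      apply Finset.sum_congr rfl
      intro m hm
      rw [Finset.mem_range] at hm
      simp only
      rw [show n - (n - m) = m by omega]
    rw [h2, ← this]
    apply Finset.sum_congr rfl
    intro j _
    by_cases hj : 1 ≤ (j : ℕ) ∧ (j : ℕ) ≤ n
    · rw [if_pos hj]
      rw [← ih (n - j) (by omega), Finset.sum_mul]
      apply Finset.sum_congr rfl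
      intro s _
      simp only [Fin.snocEquiv_apply]
      rw [ite_mul, zero_mul]
      by_cases hs : (∀ i, 1 ≤ (s i : ℕ)) ∧ (∑ i, (s i : ℕ)) = n - j
      · rw [if_pos hs, if_pos]
        · have e : (Fin.snocEquiv (fun _ : Fin (k + 1) => Fin (M + 1))) (j, s) =
              Fin.snoc (α := fun _ => Fin (M + 1)) s j := rfl
          rw [e, Fin.sum_univ_castSucc, Fin.prod_univ_castSucc, Real.exp_add, contacts_snoc_last]
          simp only [contacts_snoc_castSucc, Fin.snoc_castSucc, Fin.snoc_last]
          rw [hs.2, show n - (j : ℕ) + j = n by omega]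
          ring
        · constructor
          · intro i
            refine Fin.lastCases ?_ (fun i => ?_) i
            · simpa using hj.1
            · simpa using hs.1 i
          · rw [Fin.sum_univ_castSucc]
            simp only [Fin.snoc_castSucc, Fin.snoc_last]
            omega
      · rw [if_neg hs, if_neg]
        rintro ⟨h1, h2⟩
        apply hs
        constructor
        · intro i
          simpa using h1 i.castSucc
        · rw [Fin.sum_univ_castSucc] at h2
          simp only [Fin.snoc_castSucc, Fin.snoc_last] at h2
          omega
    · rw [if_neg hj]
      apply Finset.sum_eq_zero
      intro s _
      simp only [Fin.snocEquiv_apply]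
      rw [if_neg]
      rintro ⟨h1, h2⟩
      apply hj
      rw [Fin.sum_univ_castSucc] at h2
      simp only [Fin.snoc_castSucc, Fin.snoc_last] at h2
      have := h1 (Fin.last k)
      simp only [Fin.snoc_last] at this
      omega

lemma sum_Icc_YY (K : ℕ → ℝ) (u : ℕ → ℝ) (N : ℕ) (hN : 1 ≤ N) :
    ∑ k ∈ Finset.Icc 1 N, Yk K u k N = YY K u N := by
  unfold YY
  apply Finset.sum_subset
  · intro x hx; simp only [Finset.mem_range, Finset.mem_Icc] at *; omega
  · intro x hx hx'
    simp only [Finset.mem_range, Finset.mem_Icc] at *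
    have : x = 0 := by omega
    subst this
    rw [Yk, if_neg (by omega)]

lemma Zq_eq (K : ℕ → ℝ) (β h : ℝ) (ω : ℕ → ℝ) (N : ℕ) (hN : 1 ≤ N) :
    Zq K β h ω N = YY K (fun n => β * ω n + h) N := by
  rw [← sum_Icc_YY K _ N hN]
  unfold Zq
  apply Finset.sum_congr rfl
  intro k _
  exact bridge K (fun n => β * ω n + h) N k N le_rfl

lemma Zhom_eq (K : ℕ → ℝ) (v : ℝ) (N : ℕ) :
    Zhom K v N = YY K (fun _ => v) N := by
  unfold Zhom
  split_ifs with h0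
  · subst h0; rw [YY_zero]
  · rw [← sum_Icc_YY K _ N (by omega)]
    apply Finset.sum_congr rfl
    intro k _
    rw [← bridge K (fun _ => v) N k N le_rfl]
    simp

lemma YY_pos (K : ℕ → ℝ) (hK : ∀ n, 1 ≤ n → 0 < K n) (u : ℕ → ℝ) : ∀ n, 0 < YY K u n := by
  intro n
  induction n using Nat.strong_induction_on with
  | _ n ih =>
    rcases Nat.eq_zero_or_pos n with h0 | h0
    · subst h0; rw [YY_zero]; exact one_pos
    · rw [YY_rec K u n h0]
      apply Finset.sum_pos
      · intro m hm
        rw [Finset.mem_range] at hm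
        exact mul_pos (ih m hm) (mul_pos (hK _ (by omega)) (Real.exp_pos _))
      · exact ⟨0, by simpa using h0⟩

lemma sum_K_le (K : ℕ → ℝ) (hK : ∀ n, 1 ≤ n → 0 < K n) (hS : ∑' n : ℕ, K (n + 1) = 1) (n : ℕ) :
    ∑ m ∈ Finset.range n, K (n - m) ≤ 1 := by
  have hsum : Summable (fun n => K (n + 1)) := by
    by_contra hc
    rw [tsum_eq_zero_of_not_summable hc] at hS
    exact zero_ne_one hS
  have h1 : ∑ m ∈ Finset.range n, K (n - m) = ∑ j ∈ Finset.range n, K (j + 1) := by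
    rw [← Finset.sum_range_reflect]
    apply Finset.sum_congr rfl
    intro m hm
    rw [Finset.mem_range] at hm
    congr 1; omega
  rw [h1, ← hS]
  exact hsum.sum_le_tsum _ (fun j _ => (hK _ (by omega)).le)

/-- Number of changes of `u` on `1..n`. -/
noncomputable def ch (u : ℕ → ℝ) (n : ℕ) : ℕ :=
  ((Finset.Icc 2 n).filter (fun j => u j ≠ u (j - 1))).card

/-- Accumulated local free energy. -/
noncomputable def phi (f : ℝ → ℝ) (u : ℕ → ℝ) (n : ℕ) : ℝ := ∑ j ∈ Finset.range n, f (u (j + 1))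

lemma ch_mono (u : ℕ → ℝ) {m n : ℕ} (h : m ≤ n) : ch u m ≤ ch u n := by
  unfold ch
  apply Finset.card_le_card
  apply Finset.filter_subset_filter
  exact Finset.Icc_subset_Icc_right h

lemma const_of_no_change (u : ℕ → ℝ) (m n : ℕ) (h : ∀ j, m + 2 ≤ j → j ≤ n → u j = u (j - 1)) :
    ∀ j, m + 1 ≤ j → j ≤ n → u j = u (m + 1) := by
  intro j hj
  induction j, hj using Nat.le_induction with
  | base => intro _; rfl
  | succ j hj ih =>
    intro hn
    rw [h (j + 1) (by omega) hn, ← ih (by omega)]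
    rfl

lemma ch_lt (u : ℕ → ℝ) {m j n : ℕ} (h1 : 1 ≤ j) (h2 : m ≤ j) (h3 : j + 1 ≤ n)
    (hj : u (j + 1) ≠ u j) : ch u m + 1 ≤ ch u n := by
  unfold ch
  rw [← Finset.card_insert_of_notMem (a := j + 1)
    (s := (Finset.Icc 2 m).filter (fun j => u j ≠ u (j - 1)))]
  · apply Finset.card_le_card
    intro x hx
    simp only [Finset.mem_insert, Finset.mem_filter, Finset.mem_Icc] at *
    rcases hx with rfl | hx
    · exact ⟨by omega, hj⟩
    · exact ⟨by omega, hx.2⟩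
  · simp; omega

lemma exists_change (u : ℕ → ℝ) (m n : ℕ) (h : ¬ ∀ j, m + 1 ≤ j → j ≤ n → u j = u n) :
    ∃ j, m + 1 ≤ j ∧ j + 1 ≤ n ∧ u (j + 1) ≠ u j := by
  by_contra hc
  push Not at hc
  apply h
  have := const_of_no_change u m n (fun j hj hn => by
    have := hc (j - 1) (by omega) (by omega)
    rwa [show j - 1 + 1 = j by omega] at this)
  intro j hj hn
  rw [this j hj hn, this n (by omega) le_rfl]

lemma phi_const (f : ℝ → ℝ) (u : ℕ → ℝ) (m n : ℕ) (hmn : m ≤ n) (v : ℝ)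
    (h : ∀ j, m + 1 ≤ j → j ≤ n → u j = v) :
    phi f u n = phi f u m + ((n - m : ℕ) : ℝ) * f v := by
  unfold phi
  rw [← Finset.sum_range_add_sum_Ico _ hmn]
  congr 1
  rw [Finset.sum_congr rfl (g := fun _ => f v)]
  · simp
  · intro j hj
    rw [Finset.mem_Ico] at hj
    rw [h (j + 1) (by omega) (by omega)]

lemma phi_mono (f : ℝ → ℝ) (u : ℕ → ℝ) (hf : ∀ v, 0 ≤ f v) {m n : ℕ} (hmn : m ≤ n) :
    phi f u m ≤ phi f u n := by
  unfold phi
  apply Finset.sum_le_sum_of_subset_of_nonneg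
  · exact Finset.range_mono hmn
  · intro i _ _; exact hf _

lemma upper (K : ℕ → ℝ) (hK : ∀ n, 1 ≤ n → 0 < K n) (hS : ∑' n : ℕ, K (n + 1) = 1)
    (f : ℝ → ℝ) (hf : ∀ v, 0 ≤ f v)
    (hsub : ∀ v n, ∑ m ∈ Finset.range n,
      K (n - m) * Real.exp (v - ((n - m : ℕ) : ℝ) * f v) ≤ 1)
    (u : ℕ → ℝ) (D : ℝ) (hD : 1 ≤ D) (huD : ∀ j, Real.exp (u j) ≤ D) :
    ∀ n, YY K u n ≤ Real.exp (phi f u n) * (D * (n + 1)) ^ (ch u n) := by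
  intro n
  induction n using Nat.strong_induction_on with
  | _ n ih =>
    rcases Nat.eq_zero_or_pos n with h0 | h0
    · subst h0; rw [YY_zero]; simp [phi, ch]
    rw [YY_rec K u n h0]
    have hn1 : (1 : ℝ) ≤ n := by exact_mod_cast h0
    have hDn : 1 ≤ D * n := one_le_mul_of_one_le_of_one_le hD hn1
    have key : ∀ m ∈ Finset.range n,
        YY K u m ≤ Real.exp (phi f u m) * (D * n) ^ (ch u m) := by
      intro m hm
      rw [Finset.mem_range] at hm
      refine (ih m hm).trans ?_
      have : (m : ℝ) + 1 ≤ n := by exact_mod_cast hm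
      gcongr
    have case1 : ∀ m ∈ Finset.range n, (∀ j, m + 1 ≤ j → j ≤ n → u j = u n) →
        YY K u m * (K (n - m) * Real.exp (u n)) ≤ Real.exp (phi f u n) * (D * n) ^ (ch u n) *
          (K (n - m) * Real.exp (u n - ((n - m : ℕ) : ℝ) * f (u n))) := by
      intro m hm hc
      have hm' := Finset.mem_range.1 hm
      have hKp := hK (n - m) (by omega)
      have e := phi_const f u m n hm'.le (u n) hc
      have : YY K u m ≤ Real.exp (phi f u m) * (D * n) ^ (ch u n) := by
        refine (key m hm).trans ?_
        gcongr
        · exact ch_mono u hm'.le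
      calc _ ≤ Real.exp (phi f u m) * (D * n) ^ (ch u n) * (K (n - m) * Real.exp (u n)) := by
            gcongr
        _ = _ := by
            rw [e, Real.exp_sub, Real.exp_add]
            field_simp
    have hs1 := hsub (u n) n
    rcases hc : ch u n with _ | c
    · calc _ ≤ ∑ m ∈ Finset.range n, Real.exp (phi f u n) * (D * n) ^ (ch u n) *
          (K (n - m) * Real.exp (u n - ((n - m : ℕ) : ℝ) * f (u n))) := by
            apply Finset.sum_le_sum
            intro m hm
            apply case1 m hm
            by_contra hcon
            obtain ⟨j, h1, h2, h3⟩ := exists_change u m n hcon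
            have := ch_lt u (m := m) (by omega) (by omega) h2 h3
            omega
        _ ≤ _ := by
            rw [← Finset.mul_sum, hc]
            simp only [pow_zero, mul_one]
            have := Real.exp_pos (phi f u n)
            nlinarith
    · have case2 : ∀ m ∈ Finset.range n, YY K u m * (K (n - m) * Real.exp (u n)) ≤
          Real.exp (phi f u n) * (D * n) ^ (c + 1) *
          (K (n - m) * Real.exp (u n - ((n - m : ℕ) : ℝ) * f (u n))) +
          Real.exp (phi f u n) * (D * n) ^ c * D * K (n - m) := by
        intro m hm
        have hm' := Finset.mem_range.1 hm
        have hKp := hK (n - m) (by omega)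
        by_cases hcon : ∀ j, m + 1 ≤ j → j ≤ n → u j = u n
        · have := case1 m hm hcon
          rw [hc] at this
          refine this.trans (le_add_of_nonneg_right ?_)
          positivity
        · obtain ⟨j, h1, h2, h3⟩ := exists_change u m n hcon
          have h4 := ch_lt u (m := m) (by omega) (by omega) h2 h3
          have h5 : ch u m ≤ c := by omega
          refine le_trans ?_ (le_add_of_nonneg_left (by positivity))
          have : YY K u m ≤ Real.exp (phi f u n) * (D * n) ^ c := by
            refine (key m hm).trans ?_
            gcongr
            exact phi_mono f u hf hm'.le
          calc _ ≤ Real.exp (phi f u n) * (D * n) ^ c * (K (n - m) * D) := by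
                gcongr
                exact huD n
            _ = _ := by ring
      calc _ ≤ _ := Finset.sum_le_sum case2
        _ ≤ Real.exp (phi f u n) * (D * n) ^ (c + 1) * 1 +
            Real.exp (phi f u n) * (D * n) ^ c * D * 1 := by
            rw [Finset.sum_add_distrib, ← Finset.mul_sum, ← Finset.mul_sum]
            have := sum_K_le K hK hS n
            gcongr
        _ = Real.exp (phi f u n) * ((D * n) ^ c * (D * (n + 1))) := by ring
        _ ≤ _ := by
            rw [pow_succ]
            gcongr
            linarith

lemma YY_split (K : ℕ → ℝ) (hK : ∀ n, 1 ≤ n → 0 < K n) (u : ℕ → ℝ) (a : ℕ) (v : ℝ) :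
    ∀ d, (∀ j, a + 1 ≤ j → j ≤ a + d → u j = v) →
      YY K u a * YY K (fun _ => v) d ≤ YY K u (a + d) := by
  intro d
  induction d using Nat.strong_induction_on with
  | _ d ih =>
    intro hu
    rcases Nat.eq_zero_or_pos d with h0 | h0
    · subst h0; rw [YY_zero]; simp
    rw [YY_rec K u (a + d) (by omega), YY_rec K _ d h0, hu (a + d) (by omega) le_rfl,
      Finset.sum_range_add, Finset.mul_sum]
    refine le_trans ?_ (le_add_of_nonneg_left ?_)
    · apply Finset.sum_le_sum
      intro m hm
      rw [Finset.mem_range] at hm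
      have hKp := hK (d - m) (by omega)
      rw [show a + d - (a + m) = d - m by omega, ← mul_assoc]
      have := ih m hm (fun j h1 h2 => hu j h1 (by omega))
      gcongr
    · apply Finset.sum_nonneg
      intro m hm
      rw [Finset.mem_range] at hm
      have hKp := hK (a + d - m) (by omega)
      have := YY_pos K hK u m
      positivity

lemma lower (K : ℕ → ℝ) (hK : ∀ n, 1 ≤ n → 0 < K n)
    (f : ℝ → ℝ) (u : ℕ → ℝ) (ε C : ℝ)
    (hl : ∀ j n : ℕ, (n : ℝ) * (f (u j) - ε) - C ≤ Real.log (YY K (fun _ => u j) n)) :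
    ∀ n, phi f u n - ε * n - C * (ch u n + 1) ≤ Real.log (YY K u n) := by
  have hC : 0 ≤ C := by
    have := hl 0 0
    rw [YY_zero] at this
    simp at this
    exact this
  intro n
  induction n using Nat.strong_induction_on with
  | _ n ih =>
    have main : ∀ a, a ≤ n → (∀ j, a + 1 ≤ j → j ≤ n → u j = u n) →
        Real.log (YY K u a) + ((n : ℝ) - a) * (f (u n) - ε) - C ≤ Real.log (YY K u n) := by
      intro a ha hu
      have h1 := YY_split K hK u a (u n) (n - a) (fun j h1 h2 => hu j h1 (by omega))
      rw [show a + (n - a) = n by omega] at h1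
      have p1 := YY_pos K hK u a
      have p2 := YY_pos K hK (fun _ => u n) (n - a)
      have h2 := Real.log_le_log (mul_pos p1 p2) h1
      rw [Real.log_mul p1.ne' p2.ne'] at h2
      have h3 := hl n (n - a)
      rw [Nat.cast_sub ha] at h3
      linarith
    by_cases hcon : ∀ j, 0 + 1 ≤ j → j ≤ n → u j = u n
    · have h1 := main 0 (by omega) hcon
      rw [YY_zero, Real.log_one] at h1
      have h2 := phi_const f u 0 n (by omega) (u n) hcon
      simp [phi] at h2 h1
      have h3 : 0 ≤ C * (ch u n : ℝ) := by positivity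
      rw [phi, h2]
      linarith
    · obtain ⟨j0, hj0⟩ := exists_change u 0 n hcon
      let P : ℕ → Prop := fun j => 0 + 1 ≤ j ∧ j + 1 ≤ n ∧ u (j + 1) ≠ u j
      classical
      set a := Nat.findGreatest P n with ha
      have hPa : P a := Nat.findGreatest_spec (P := P) (m := j0) (by omega) hj0
      have hmax : ∀ j, a + 1 ≤ j → j ≤ n → u j = u n := by
        by_contra hc
        obtain ⟨j, h1, h2, h3⟩ := exists_change u a n hc
        have : j ≤ a := Nat.le_findGreatest (P := P) (by omega) ⟨by omega, h2, h3⟩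
        omega
      obtain ⟨h1, h2, h3⟩ := hPa
      have h4 := main a (by omega) hmax
      have h5 := phi_const f u a n (by omega) (u n) hmax
      rw [Nat.cast_sub (by omega)] at h5
      have h6 := ih a (by omega)
      have h7 := ch_lt u (m := a) (by omega) le_rfl h2 h3
      have h8 : (ch u a : ℝ) + 1 ≤ ch u n := by exact_mod_cast h7
      have h9 := mul_le_mul_of_nonneg_left h8 hC
      nlinarith

lemma F_sub (K : ℕ → ℝ) (hK : ∀ n, 1 ≤ n → 0 < K n) (v Fv : ℝ)
    (hF : Tendsto (fun N : ℕ => Real.log (YY K (fun _ => v) N) / N) atTop (𝓝 Fv)) (n : ℕ) :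
    ∑ m ∈ Finset.range n, K (n - m) * Real.exp (v - ((n - m : ℕ) : ℝ) * Fv) ≤ 1 := by
  by_contra hcon
  push Not at hcon
  have hcont : Continuous (fun g : ℝ =>
      ∑ m ∈ Finset.range n, K (n - m) * Real.exp (v - ((n - m : ℕ) : ℝ) * g)) := by fun_prop
  have hev : ∀ᶠ g in 𝓝[>] Fv, 1 <
      ∑ m ∈ Finset.range n, K (n - m) * Real.exp (v - ((n - m : ℕ) : ℝ) * g) :=
    (hcont.continuousAt.eventually_const_lt hcon).filter_mono nhdsWithin_le_nhds
  obtain ⟨g, hg, hgF⟩ := (hev.and self_mem_nhdsWithin).exists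
  have hn : 0 < n := by
    rcases Nat.eq_zero_or_pos n with h0 | h0
    · subst h0; simp at hg; linarith
    · exact h0
  have hpos := YY_pos K hK (fun _ => v)
  obtain ⟨k0, hk0, hmin⟩ := Finset.exists_min_image (Finset.range n)
    (fun k : ℕ => YY K (fun _ => v) k * Real.exp (-(k * g))) ⟨0, by simpa using hn⟩
  set c := YY K (fun _ => v) k0 * Real.exp (-(k0 * g)) with hc
  have hcpos : 0 < c := mul_pos (hpos _) (Real.exp_pos _)
  have hall : ∀ k : ℕ, c ≤ YY K (fun _ => v) k * Real.exp (-(k * g)) := by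
    intro k
    induction k using Nat.strong_induction_on with
    | _ k ih =>
      by_cases hk : k < n
      · exact hmin k (by simpa using hk)
      · obtain ⟨d, rfl⟩ : ∃ d, k = d + n := ⟨k - n, by omega⟩
        rw [YY_rec K _ (d + n) (by omega), Finset.sum_range_add, add_mul]
        refine le_trans ?_ (le_add_of_nonneg_left ?_)
        · calc c ≤ c * ∑ m ∈ Finset.range n,
                K (n - m) * Real.exp (v - ((n - m : ℕ) : ℝ) * g) := by nlinarith
            _ ≤ _ := by
              rw [Finset.mul_sum, Finset.sum_mul]
              apply Finset.sum_le_sum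
              intro m hm
              rw [Finset.mem_range] at hm
              have hKp := hK (n - m) (by omega)
              have h1 := ih (d + m) (by omega)
              calc _ ≤ (YY K (fun _ => v) (d + m) * Real.exp (-(((d + m : ℕ) : ℝ) * g))) *
                    (K (n - m) * Real.exp (v - ((n - m : ℕ) : ℝ) * g)) := by gcongr
                _ = YY K (fun _ => v) (d + m) * K (n - m) *
                    (Real.exp (-(((d + m : ℕ) : ℝ) * g)) *
                      Real.exp (v - ((n - m : ℕ) : ℝ) * g)) := by ring
                _ = YY K (fun _ => v) (d + m) * K (n - m) *
                    (Real.exp v * Real.exp (-(((d + n : ℕ) : ℝ) * g))) := by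
                    rw [← Real.exp_add, ← Real.exp_add, Nat.cast_sub hm.le]
                    push_cast
                    ring_nf
                _ = _ := by rw [show d + n - (d + m) = n - m by omega]; ring
        · apply mul_nonneg _ (Real.exp_pos _).le
          apply Finset.sum_nonneg
          intro m hm
          rw [Finset.mem_range] at hm
          have hKp := hK (d + n - m) (by omega)
          have := hpos m
          positivity
  have hlim : Tendsto (fun N : ℕ => Real.log c / N + g) atTop (𝓝 (0 + g)) :=
    (tendsto_const_div_atTop_nhds_zero_nat _).add_const g
  rw [zero_add] at hlim
  have : g ≤ Fv := by
    apply le_of_tendsto_of_tendsto hlim hF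
    filter_upwards [eventually_ge_atTop 1] with N hN
    have hN' : (0 : ℝ) < N := by exact_mod_cast hN
    have h1 := Real.log_le_log hcpos (hall N)
    rw [Real.log_mul (hpos N).ne' (Real.exp_pos _).ne', Real.log_exp] at h1
    rw [le_div_iff₀ hN', add_mul, div_mul_cancel₀ _ hN'.ne']
    linarith
  linarith

lemma F_nonneg (α : ℝ) (L K : ℕ → ℝ)
    (hL : ∀ c : ℝ, 0 < c →
      Tendsto (fun n : ℕ => L ⌊c * (n : ℝ)⌋₊ / L n) atTop (𝓝 1))
    (hKL : ∀ n : ℕ, 1 ≤ n → K n = L n * (n : ℝ) ^ (-(1 + α)))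
    (hK : ∀ n, 1 ≤ n → 0 < K n) (v Fv : ℝ)
    (hF : Tendsto (fun N : ℕ => Real.log (YY K (fun _ => v) N) / N) atTop (𝓝 Fv)) :
    0 ≤ Fv := by
  have hLpos : ∀ n, 1 ≤ n → 0 < L n := by
    intro n hn
    have h1 := hK n hn
    rw [hKL n hn] at h1
    exact pos_of_mul_pos_left h1 (by positivity)
  have h2 := hL 2 (by norm_num)
  have hev := (h2.eventually_const_le (show (1 / 2 : ℝ) < 1 by norm_num)).and
    (eventually_ge_atTop 1)
  obtain ⟨n0, hn0⟩ := hev.exists_forall_of_atTop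
  set n1 := max n0 1 with hn1
  have hn1' : 1 ≤ n1 := le_max_right _ _
  set q : ℝ := (1 / 2) * (2 : ℝ) ^ (-(1 + α)) with hq
  have hqpos : 0 < q := by positivity
  have hstep : ∀ n, n1 ≤ n → q * K n ≤ K (2 * n) := by
    intro n hn
    have hn' : 1 ≤ n := hn1'.trans hn
    obtain ⟨h3, _⟩ := hn0 n ((le_max_left _ _).trans hn)
    have e : ⌊(2 : ℝ) * (n : ℝ)⌋₊ = 2 * n := by
      rw [show (2 : ℝ) * (n : ℝ) = ((2 * n : ℕ) : ℝ) by push_cast; ring, Nat.floor_natCast]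
    rw [e, le_div_iff₀ (hLpos n hn')] at h3
    rw [hKL n hn', hKL (2 * n) (by omega)]
    push_cast
    rw [Real.mul_rpow (by norm_num) (by positivity), hq]
    have : 0 ≤ (2 : ℝ) ^ (-(1 + α)) * (n : ℝ) ^ (-(1 + α)) := by positivity
    calc _ = (1 / 2 * L n) * ((2 : ℝ) ^ (-(1 + α)) * (n : ℝ) ^ (-(1 + α))) := by ring
      _ ≤ _ := by gcongr
  have hpow : ∀ j : ℕ, q ^ j * K n1 ≤ K (2 ^ j * n1) := by
    intro j
    induction j with
    | zero => simp
    | succ j ih =>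
      have := hstep (2 ^ j * n1) (Nat.le_mul_of_pos_left _ (by positivity))
      rw [show 2 ^ (j + 1) * n1 = 2 * (2 ^ j * n1) by ring]
      refine le_trans ?_ this
      rw [pow_succ]
      nlinarith
  have hsub : Tendsto (fun j : ℕ => 2 ^ j * n1) atTop atTop := by
    apply tendsto_atTop_mono (f := fun j : ℕ => j) _ tendsto_id
    intro j
    have := (Nat.lt_two_pow_self (n := j)).le
    nlinarith
  have hF2 := hF.comp hsub
  have hlow : Tendsto (fun j : ℕ => (Real.log q / n1) * ((j : ℝ) * (1 / 2 : ℝ) ^ j) +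
      ((Real.log (K n1) + v) / n1) * (1 / 2 : ℝ) ^ j) atTop (𝓝 ((Real.log q / n1) * 0 +
        ((Real.log (K n1) + v) / n1) * 0)) := by
    apply Tendsto.add
    · exact (tendsto_self_mul_const_pow_of_lt_one (by norm_num) (by norm_num)).const_mul _
    · exact (tendsto_pow_atTop_nhds_zero_of_lt_one (by norm_num) (by norm_num)).const_mul _
  rw [mul_zero, mul_zero, add_zero] at hlow
  apply le_of_tendsto_of_tendsto' hlow hF2
  intro j
  simp only [Function.comp]
  have hN : 1 ≤ 2 ^ j * n1 := Nat.mul_pos (by positivity) hn1'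
  have hY : q ^ j * K n1 * Real.exp v ≤ YY K (fun _ => v) (2 ^ j * n1) := by
    rw [YY_rec K _ _ hN]
    have h1 : YY K (fun _ => v) 0 * (K (2 ^ j * n1 - 0) * Real.exp v) ≤
        ∑ m ∈ Finset.range (2 ^ j * n1),
          YY K (fun _ => v) m * (K (2 ^ j * n1 - m) * Real.exp v) := by
      apply Finset.single_le_sum (f := fun m => YY K (fun _ => v) m *
        (K (2 ^ j * n1 - m) * Real.exp v))
      · intro m hm
        rw [Finset.mem_range] at hm
        have h1 := hK (2 ^ j * n1 - m) (by omega)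
        have h2 := YY_pos K hK (fun _ => v) m
        positivity
      · rw [Finset.mem_range]; omega
    refine le_trans ?_ h1
    rw [YY_zero, one_mul, Nat.sub_zero]
    have := hpow j
    gcongr
  have hk1 := hK n1 hn1'
  have h5 := Real.log_le_log (by positivity) hY
  rw [Real.log_mul (by positivity) (by positivity), Real.log_mul (by positivity) (by positivity),
    Real.log_exp, Real.log_pow] at h5
  have hn1r : (0 : ℝ) < n1 := by exact_mod_cast hn1'
  push_cast
  rw [le_div_iff₀ (by positivity)]
  refine le_trans (le_of_eq ?_) h5
  have e : (1 / 2 : ℝ) ^ j * 2 ^ j = 1 := by rw [← mul_pow]; norm_num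
  calc _ = (Real.log q / n1 * n1) * j * ((1 / 2 : ℝ) ^ j * 2 ^ j) +
      ((Real.log (K n1) + v) / n1 * n1) * ((1 / 2 : ℝ) ^ j * 2 ^ j) := by ring
    _ = _ := by
      rw [e, div_mul_cancel₀ _ hn1r.ne', div_mul_cancel₀ _ hn1r.ne']; ring

lemma F_nonpos (K : ℕ → ℝ) (hK : ∀ n, 1 ≤ n → 0 < K n) (hS : ∑' n : ℕ, K (n + 1) = 1)
    (v Fv : ℝ) (hv : v ≤ 0)
    (hF : Tendsto (fun N : ℕ => Real.log (YY K (fun _ => v) N) / N) atTop (𝓝 Fv)) :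
    Fv ≤ 0 := by
  have h1 : ∀ n, YY K (fun _ => v) n ≤ 1 := by
    intro n
    induction n using Nat.strong_induction_on with
    | _ n ih =>
      rcases Nat.eq_zero_or_pos n with h0 | h0
      · subst h0; rw [YY_zero]
      rw [YY_rec K _ n h0]
      refine le_trans ?_ (sum_K_le K hK hS n)
      apply Finset.sum_le_sum
      intro m hm
      rw [Finset.mem_range] at hm
      have hKp := hK (n - m) (by omega)
      have he : Real.exp v ≤ 1 := Real.exp_le_one_iff.2 hv
      calc _ ≤ 1 * (K (n - m) * 1) := by
            have := ih m hm
            gcongr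
        _ = _ := by ring
  apply le_of_tendsto' hF
  intro N
  exact div_nonpos_of_nonpos_of_nonneg
    (Real.log_nonpos (YY_pos K hK _ N).le (h1 N)) (by positivity)

lemma unif_lower (K : ℕ → ℝ) (v Fv : ℝ)
    (hF : Tendsto (fun N : ℕ => Real.log (YY K (fun _ => v) N) / N) atTop (𝓝 Fv))
    (ε : ℝ) (hε : 0 < ε) :
    ∃ C : ℝ, 0 ≤ C ∧ ∀ n : ℕ, (n : ℝ) * (Fv - ε) - C ≤ Real.log (YY K (fun _ => v) n) := by
  have hev := (hF.eventually_const_le (show Fv - ε < Fv by linarith)).and (eventually_ge_atTop 1)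
  obtain ⟨n0, hn0⟩ := hev.exists_forall_of_atTop
  refine ⟨∑ n ∈ Finset.range n0, |(n : ℝ) * (Fv - ε) - Real.log (YY K (fun _ => v) n)|,
    Finset.sum_nonneg (fun _ _ => abs_nonneg _), ?_⟩
  intro n
  by_cases hn : n < n0
  · have := Finset.single_le_sum (f := fun n : ℕ =>
      |(n : ℝ) * (Fv - ε) - Real.log (YY K (fun _ => v) n)|) (s := Finset.range n0)
      (fun _ _ => abs_nonneg _) (Finset.mem_range.2 hn)
    have h2 := le_abs_self ((n : ℝ) * (Fv - ε) - Real.log (YY K (fun _ => v) n))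
    linarith
  · obtain ⟨h1, h2⟩ := hn0 n (by omega)
    have hN' : (0 : ℝ) < n := by exact_mod_cast h2
    rw [le_div_iff₀ hN'] at h1
    have : 0 ≤ ∑ n ∈ Finset.range n0, |(n : ℝ) * (Fv - ε) - Real.log (YY K (fun _ => v) n)| :=
      Finset.sum_nonneg (fun _ _ => abs_nonneg _)
    linarith

lemma chain_sum : ∀ (n : ℕ) (g : Fin n → Bool → ℝ),
    ∑ w : Fin (n + 1) → Bool, ∏ i : Fin n, g i (decide (w i.castSucc = w i.succ)) =
      2 * ∏ i : Fin n, (g i true + g i false) := by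
  intro n
  induction n with
  | zero => intro g; simp
  | succ n ih =>
    intro g
    rw [← (Fin.consEquiv (fun _ : Fin (n + 2) => Bool)).sum_comp, Fintype.sum_prod_type_right,
      Fin.prod_univ_succ]
    have := ih (fun i => g i.succ)
    rw [show 2 * ((g 0 true + g 0 false) * ∏ i : Fin n, (g i.succ true + g i.succ false)) =
      (g 0 true + g 0 false) * (2 * ∏ i : Fin n, (g i.succ true + g i.succ false)) by ring,
      ← this, Finset.mul_sum]
    apply Finset.sum_congr rfl
    intro w _
    simp only [Fin.prod_univ_succ, Fin.consEquiv_apply, Fin.cons_succ, Fin.castSucc_zero,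
      Fin.cons_zero, ← Fin.succ_castSucc]
    rw [← Finset.sum_mul]
    congr 1
    rcases hw : w 0 <;> simp [add_comm]

lemma pathProb_eq (γ : ℝ) (N : ℕ) (w : Fin (N + 2) → Bool) :
    pathProb γ N w = (1 / 2) * ∏ i : Fin (N + 1),
      (fun (_ : Fin (N + 1)) (b : Bool) => if b = true then 1 - (N : ℝ) ^ (-γ) else (N : ℝ) ^ (-γ))
        i (decide (w i.castSucc = w i.succ)) := by
  simp [pathProb]

lemma pathProb_sum (γ : ℝ) (N : ℕ) : ∑ w : Fin (N + 2) → Bool, pathProb γ N w = 1 := by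
  simp only [pathProb_eq]
  rw [← Finset.mul_sum]
  have h := chain_sum (N + 1)
    (fun (_ : Fin (N + 1)) (b : Bool) => if b = true then 1 - (N : ℝ) ^ (-γ) else (N : ℝ) ^ (-γ))
  refine (congrArg (fun x => (1 / 2 : ℝ) * x) h).trans ?_
  simp

lemma pathProb_change (γ : ℝ) (N : ℕ) (j : Fin (N + 1)) :
    ∑ w : Fin (N + 2) → Bool, pathProb γ N w * (if w j.castSucc = w j.succ then 0 else 1) =
      (N : ℝ) ^ (-γ) := by
  have h := chain_sum (N + 1) (fun i b => (if b = true then 1 - (N : ℝ) ^ (-γ) else (N : ℝ) ^ (-γ)) *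
    (if i = j then (if b = true then 0 else 1) else 1))
  have e : ∀ i : Fin (N + 1), (((if true = true then 1 - (N : ℝ) ^ (-γ) else (N : ℝ) ^ (-γ)) *
    (if i = j then (if true = true then 0 else 1) else 1)) +
    ((if false = true then 1 - (N : ℝ) ^ (-γ) else (N : ℝ) ^ (-γ)) *
    (if i = j then (if false = true then 0 else 1) else 1))) =
      if i = j then (N : ℝ) ^ (-γ) else 1 := by
    intro i
    by_cases h : i = j <;> simp [h]
  rw [Finset.prod_congr rfl (fun i _ => e i)] at h
  simp only [Finset.prod_ite_eq', Finset.mem_univ, if_true] at h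
  have h3 : (N : ℝ) ^ (-γ) = (1 / 2) * (2 * (N : ℝ) ^ (-γ)) := by ring
  rw [h3, ← h, Finset.mul_sum]
  apply Finset.sum_congr rfl
  intro w _
  rw [pathProb_eq, Finset.prod_mul_distrib, mul_assoc]
  congr 2
  simp [Finset.prod_ite_eq']

lemma pathProb_flip (γ : ℝ) (N : ℕ) (w : Fin (N + 2) → Bool) :
    pathProb γ N (fun i => !(w i)) = pathProb γ N w := by
  simp [pathProb]

lemma pathProb_nonneg (γ : ℝ) (hγ : 0 < γ) (N : ℕ) (hN : 1 ≤ N) (w : Fin (N + 2) → Bool) :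
    0 ≤ pathProb γ N w := by
  unfold pathProb
  have h1 : (N : ℝ) ^ (-γ) ≤ 1 :=
    Real.rpow_le_one_of_one_le_of_nonpos (by exact_mod_cast hN) (by linarith)
  have h2 : 0 ≤ (N : ℝ) ^ (-γ) := by positivity
  apply mul_nonneg (by norm_num)
  apply Finset.prod_nonneg
  intro i _
  split_ifs <;> linarith

lemma pathProb_marginal (γ : ℝ) (N : ℕ) (j : Fin (N + 2)) (g : Bool → ℝ) :
    ∑ w : Fin (N + 2) → Bool, pathProb γ N w * g (w j) = (g true + g false) / 2 := by
  let e : (Fin (N + 2) → Bool) ≃ (Fin (N + 2) → Bool) :=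
    ⟨fun w i => !(w i), fun w i => !(w i), fun w => by simp, fun w => by simp⟩
  have h1 : ∑ w : Fin (N + 2) → Bool, pathProb γ N w * g (w j) =
      ∑ w : Fin (N + 2) → Bool, pathProb γ N w * g (!(w j)) := by
    rw [← e.sum_comp]
    apply Finset.sum_congr rfl
    intro w _
    show pathProb γ N (fun i => !(w i)) * _ = _
    rw [pathProb_flip]
    rfl
  have h2 : ∑ w : Fin (N + 2) → Bool, pathProb γ N w * g (w j) +
      ∑ w : Fin (N + 2) → Bool, pathProb γ N w * g (!(w j)) = g true + g false := by
    rw [← Finset.sum_add_distrib, ← one_mul (g true + g false), ← pathProb_sum γ N, Finset.sum_mul]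
    apply Finset.sum_congr rfl
    intro w _
    rcases w j <;> simp <;> ring
  linarith

lemma omegaOf_cases (N : ℕ) (w : Fin (N + 2) → Bool) (j : ℕ) :
    omegaOf N w j = 1 ∨ omegaOf N w j = -1 := by
  unfold omegaOf
  split_ifs <;> simp

lemma expect_phi (γ : ℝ) (N : ℕ) (F : ℝ → ℝ) (β h : ℝ) :
    ∑ w : Fin (N + 2) → Bool, pathProb γ N w * phi F (fun n => β * omegaOf N w n + h) N =
      N * ((F (h + β) + F (h - β)) / 2) := by
  unfold phi
  simp only [Finset.mul_sum]
  rw [Finset.sum_comm]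
  rw [Finset.sum_congr rfl (g := fun _ => (F (h + β) + F (h - β)) / 2)]
  · simp
  · intro j hj
    rw [Finset.mem_range] at hj
    have := pathProb_marginal γ N ⟨j + 1, by omega⟩ (fun b => F (β * (if b then 1 else -1) + h))
    simp only [if_true] at this
    rw [show β * 1 + h = h + β by ring] at this
    rw [show β * (if false = true then (1 : ℝ) else -1) + h = h - β by simp; ring] at this
    rw [← this]
    apply Finset.sum_congr rfl
    intro w _
    rw [omegaOf, dif_pos (by omega)]

lemma expect_ch (γ : ℝ) (hγ : 0 < γ) (N : ℕ) (hN : 1 ≤ N) (β h : ℝ) :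
    ∑ w : Fin (N + 2) → Bool, pathProb γ N w * (ch (fun n => β * omegaOf N w n + h) N : ℝ) ≤
      (N + 1) * (N : ℝ) ^ (-γ) := by
  have hle : ∀ w : Fin (N + 2) → Bool, (ch (fun n => β * omegaOf N w n + h) N : ℝ) ≤
      ∑ j : Fin (N + 1), (if w j.castSucc = w j.succ then (0 : ℝ) else 1) := by
    intro w
    have h1 : ch (fun n => β * omegaOf N w n + h) N ≤
        (Finset.univ.filter (fun j : Fin (N + 1) => ¬ w j.castSucc = w j.succ)).card := by
      unfold ch
      refine le_trans (Finset.card_le_card ?_) (Finset.card_image_le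
        (f := fun i : Fin (N + 1) => (i : ℕ) + 1))
      intro x hx
      simp only [Finset.mem_filter, Finset.mem_Icc, Finset.mem_image, Finset.mem_univ,
        true_and] at *
      refine ⟨⟨x - 1, by omega⟩, ?_, by simp; omega⟩
      intro hw
      apply hx.2
      have e : omegaOf N w x = omegaOf N w (x - 1) := by
        rw [omegaOf, omegaOf, dif_pos (by omega), dif_pos (by omega)]
        have e1 : (⟨x - 1, by omega⟩ : Fin (N + 1)).castSucc = (⟨x - 1, by omega⟩ : Fin (N + 2)) :=
          rfl
        have e2 : (⟨x - 1, by omega⟩ : Fin (N + 1)).succ = (⟨x, by omega⟩ : Fin (N + 2)) := by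
          ext; simp; omega
        rw [e1, e2] at hw
        rw [hw]
      rw [e]
    have h2 : ∑ j : Fin (N + 1), (if w j.castSucc = w j.succ then (0 : ℝ) else 1) =
        ((Finset.univ.filter (fun j : Fin (N + 1) => ¬ w j.castSucc = w j.succ)).card : ℝ) := by
      rw [Finset.card_filter]
      push_cast
      apply Finset.sum_congr rfl
      intro j _
      split_ifs <;> simp_all
    rw [h2]
    exact_mod_cast h1
  calc _ ≤ ∑ w : Fin (N + 2) → Bool, pathProb γ N w *
        ∑ j : Fin (N + 1), (if w j.castSucc = w j.succ then (0 : ℝ) else 1) := by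
        apply Finset.sum_le_sum
        intro w _
        exact mul_le_mul_of_nonneg_left (hle w) (pathProb_nonneg γ hγ N hN w)
    _ = _ := by
        simp only [Finset.mul_sum]
        rw [Finset.sum_comm]
        simp only [pathProb_change]
        simp

/-- For every `β ≥ 0` and `h`, the averaged quenched free
energy `E^{(N)}[F_N(β,h,ω)]` converges to `G(β,h)` as `N → ∞`. -/
theorem statement9 (α : ℝ) (hα : 0 ≤ α) (L K : ℕ → ℝ)
    (hL : ∀ c : ℝ, 0 < c →
      Tendsto (fun n : ℕ => L ⌊c * (n : ℝ)⌋₊ / L n) atTop (𝓝 1))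
    (hKL : ∀ n : ℕ, 1 ≤ n → K n = L n * (n : ℝ) ^ (-(1 + α)))
    (hKpos : ∀ n, 1 ≤ n → 0 < K n) (hKsum : ∑' n : ℕ, K (n + 1) = 1)
    (γ : ℝ) (hγ0 : 0 < γ) (hγ1 : γ < 1)
    (F : ℝ → ℝ)
    (hF : ∀ u : ℝ, Tendsto (fun N : ℕ => Real.log (Zhom K u N) / N) atTop (𝓝 (F u)))
    (β h : ℝ) (hβ : 0 ≤ β) :
    Tendsto (fun N : ℕ => ∑ w : Fin (N + 2) → Bool,
        pathProb γ N w * (Real.log (Zq K β h (omegaOf N w) N) / N))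
      atTop (𝓝 (Gfun F β h)) := by

  have hF' : ∀ v : ℝ, Tendsto (fun N : ℕ => Real.log (YY K (fun _ => v) N) / N) atTop
      (𝓝 (F v)) := by
    intro v
    simpa only [Zhom_eq] using hF v
  have hnn : ∀ v, 0 ≤ F v := fun v => F_nonneg α L K hL hKL hKpos v _ (hF' v)
  have hzero : ∀ v, v ≤ 0 → F v = 0 := fun v hv =>
    le_antisymm (F_nonpos K hKpos hKsum v _ hv (hF' v)) (hnn v)
  have hsub : ∀ v n, ∑ m ∈ Finset.range n,
      K (n - m) * Real.exp (v - ((n - m : ℕ) : ℝ) * F v) ≤ 1 :=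
    fun v n => F_sub K hKpos v _ (hF' v) n
  have hG : Gfun F β h = (F (h + β) + F (h - β)) / 2 := by
    unfold Gfun
    split_ifs with h1 h2
    · rw [hzero (h + β) (by linarith), hzero (h - β) (by linarith)]; simp
    · rw [hzero (h - β) (by linarith)]; simp
    · rfl
  rw [hG]
  set G := (F (h + β) + F (h - β)) / 2 with hGdef
  have hdec : Tendsto (fun N : ℕ => (N : ℝ) ^ (-γ)) atTop (𝓝 0) :=
    (tendsto_rpow_neg_atTop hγ0).comp tendsto_natCast_atTop_atTop
  have hdeclog : Tendsto (fun N : ℕ => (N : ℝ) ^ (-γ) * Real.log N) atTop (𝓝 0) := by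
    have h1 := (isLittleO_log_rpow_atTop hγ0).tendsto_div_nhds_zero
    have h2 := h1.comp (tendsto_natCast_atTop_atTop (R := ℝ))
    refine h2.congr ?_
    intro N
    simp only [Function.comp]
    rw [Real.rpow_neg (by positivity)]
    field_simp
  set D : ℝ := Real.exp (β + |h|) with hD
  have hD1 : 1 ≤ D := Real.one_le_exp (by positivity)
  rw [tendsto_order]
  constructor
  · intro a ha
    obtain ⟨C1, hC1, hl1⟩ := unif_lower K (h + β) _ (hF' _) ((G - a) / 2) (by linarith)
    obtain ⟨C2, hC2, hl2⟩ := unif_lower K (h - β) _ (hF' _) ((G - a) / 2) (by linarith)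
    have hlim : Tendsto (fun N : ℕ => G - (G - a) / 2 -
        (C1 + C2) * (2 * (N : ℝ) ^ (-γ) + 1 / N)) atTop
        (𝓝 (G - (G - a) / 2 - (C1 + C2) * (2 * 0 + 0))) :=
      (((hdec.const_mul 2).add tendsto_one_div_atTop_nhds_zero_nat).const_mul _).const_sub _
    filter_upwards [hlim.eventually_const_lt (show a < _ by linarith),
      eventually_ge_atTop 1] with N hN hN1
    refine hN.trans_le ?_
    have hb : ∀ w : Fin (N + 2) → Bool, phi F (fun n => β * omegaOf N w n + h) N -
        (G - a) / 2 * N - (C1 + C2) * (ch (fun n => β * omegaOf N w n + h) N + 1) ≤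
          Real.log (Zq K β h (omegaOf N w) N) := by
      intro w
      rw [Zq_eq K β h _ N hN1]
      apply lower K hKpos F (fun n => β * omegaOf N w n + h) ((G - a) / 2) (C1 + C2)
      intro j n
      rcases omegaOf_cases N w j with hw | hw
      · simp only [hw]
        have := hl1 n
        rw [show β * 1 + h = h + β by ring]
        linarith
      · simp only [hw]
        have := hl2 n
        rw [show β * (-1) + h = h - β by ring]
        linarith
    have hmono : ∑ w : Fin (N + 2) → Bool, pathProb γ N w *
          ((phi F (fun n => β * omegaOf N w n + h) N - (G - a) / 2 * N -
            (C1 + C2) * (ch (fun n => β * omegaOf N w n + h) N + 1)) / N) ≤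
        ∑ w : Fin (N + 2) → Bool,
          pathProb γ N w * (Real.log (Zq K β h (omegaOf N w) N) / N) := by
      apply Finset.sum_le_sum
      intro w _
      apply mul_le_mul_of_nonneg_left _ (pathProb_nonneg γ hγ0 N hN1 w)
      exact div_le_div_of_nonneg_right (hb w) (by positivity)
    refine le_trans ?_ hmono
    · have hN' : (1 : ℝ) ≤ N := by exact_mod_cast hN1
      have e1 := expect_phi γ N F β h
      have e2 := expect_ch γ hγ0 N hN1 β h
      have e3 := pathProb_sum γ N
      have e : ∑ w : Fin (N + 2) → Bool, pathProb γ N w *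
          ((phi F (fun n => β * omegaOf N w n + h) N - (G - a) / 2 * N -
            (C1 + C2) * (ch (fun n => β * omegaOf N w n + h) N + 1)) / N) =
          (∑ w : Fin (N + 2) → Bool, pathProb γ N w * phi F (fun n => β * omegaOf N w n + h) N) / N
          - (G - a) / 2 * N / N * (∑ w : Fin (N + 2) → Bool, pathProb γ N w)
          - (C1 + C2) * ((∑ w : Fin (N + 2) → Bool,
              pathProb γ N w * ch (fun n => β * omegaOf N w n + h) N) +
              (∑ w : Fin (N + 2) → Bool, pathProb γ N w)) / N := by
        rw [← Finset.sum_add_distrib, Finset.mul_sum, Finset.mul_sum, Finset.sum_div,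
          Finset.sum_div, ← Finset.sum_sub_distrib, ← Finset.sum_sub_distrib]
        apply Finset.sum_congr rfl
        intro w _
        ring
      rw [e, e1, e3]
      have hNpos : (0 : ℝ) < N := by linarith
      have e4 : (∑ w : Fin (N + 2) → Bool,
              pathProb γ N w * ch (fun n => β * omegaOf N w n + h) N + 1) / N ≤
            2 * (N : ℝ) ^ (-γ) + 1 / N := by
        rw [add_div]
        gcongr
        rw [div_le_iff₀ hNpos]
        refine e2.trans ?_
        have : 0 ≤ (N : ℝ) ^ (-γ) := by positivity
        nlinarith
      have e5 := mul_le_mul_of_nonneg_left e4 (add_nonneg hC1 hC2)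
      rw [mul_div_cancel_left₀ _ hNpos.ne', mul_div_cancel_right₀ _ hNpos.ne']
      rw [mul_div_assoc (C1 + C2)]
      linarith
  · intro a ha
    have hlim : Tendsto (fun N : ℕ => G + 2 * ((N : ℝ) ^ (-γ) * Real.log (2 * D) +
        (N : ℝ) ^ (-γ) * Real.log N)) atTop (𝓝 (G + 2 * (0 * Real.log (2 * D) + 0))) :=
      (((hdec.mul_const _).add hdeclog).const_mul 2).const_add G
    filter_upwards [hlim.eventually_lt_const (show _ < a by linarith),
      eventually_ge_atTop 1] with N hN hN1
    refine lt_of_le_of_lt ?_ hN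
    have hN' : (1 : ℝ) ≤ N := by exact_mod_cast hN1
    have hNpos : (0 : ℝ) < N := by linarith
    have hlogD : Real.log (D * (N + 1)) ≤ Real.log (2 * D) + Real.log N := by
      rw [← Real.log_mul (by positivity) (by positivity)]
      apply Real.log_le_log (by positivity)
      nlinarith
    have hlog0 : 0 ≤ Real.log (D * (N + 1)) := Real.log_nonneg (by nlinarith)
    have hb : ∀ w : Fin (N + 2) → Bool, Real.log (Zq K β h (omegaOf N w) N) ≤
        phi F (fun n => β * omegaOf N w n + h) N +
          ch (fun n => β * omegaOf N w n + h) N * Real.log (D * (N + 1)) := by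
      intro w
      rw [Zq_eq K β h _ N hN1]
      have h1 := upper K hKpos hKsum F hnn hsub (fun n => β * omegaOf N w n + h) D hD1 ?_ N
      · have h2 := Real.log_le_log (YY_pos K hKpos _ N) h1
        rwa [Real.log_mul (by positivity) (by positivity), Real.log_exp, Real.log_pow] at h2
      · intro j
        apply Real.exp_le_exp.2
        have := le_abs_self h
        rcases omegaOf_cases N w j with hw | hw <;> rw [hw] <;> linarith
    calc _ ≤ ∑ w : Fin (N + 2) → Bool, pathProb γ N w *
          ((phi F (fun n => β * omegaOf N w n + h) N +
          ch (fun n => β * omegaOf N w n + h) N * Real.log (D * (N + 1))) / N) := by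
          apply Finset.sum_le_sum
          intro w _
          apply mul_le_mul_of_nonneg_left _ (pathProb_nonneg γ hγ0 N hN1 w)
          exact div_le_div_of_nonneg_right (hb w) hNpos.le
      _ = (∑ w : Fin (N + 2) → Bool, pathProb γ N w * phi F (fun n => β * omegaOf N w n + h) N) / N
          + ((∑ w : Fin (N + 2) → Bool,
              pathProb γ N w * ch (fun n => β * omegaOf N w n + h) N) / N) *
                Real.log (D * (N + 1)) := by
          rw [Finset.sum_div, Finset.sum_div, Finset.sum_mul, ← Finset.sum_add_distrib]
          apply Finset.sum_congr rfl
          intro w _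
          ring
      _ ≤ G + (2 * (N : ℝ) ^ (-γ)) * (Real.log (2 * D) + Real.log N) := by
          rw [expect_phi γ N F β h, mul_div_cancel_left₀ _ hNpos.ne']
          have e2 := expect_ch γ hγ0 N hN1 β h
          gcongr
          rw [div_le_iff₀ hNpos]
          refine e2.trans ?_
          have : 0 ≤ (N : ℝ) ^ (-γ) := by positivity
          nlinarith
      _ = _ := by ring
end

section
/- For every β ≥ 0, h ∈ ℝ and ς > 0 there exists a constant C > 0 such that for every N ≥ 1, every sequence ω taking values in {−1,+1}, and every 1 ≤ n ≤ N, one has Z_{N,β,h,ω} ≤ (1 + C N^{2+α+ς}) · Z^{(n)}_{N,β,h,ω}, where Z^{(n)}_{N,β,h,ω} denotes the partition function with the sum restricted to contact sets containing n. Consequently, Z_{N,β,h,ω} ≤ (1 + C N^{2+α+ς})^{B_N} · Z^c_{N,β,h,ω}. -/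
open Filter Topology

/-- The partition function `Z^{(n)}_{N,β,h,ω}`, with the sum restricted to
contact sets containing `n`. -/
noncomputable def Zpin (K : ℕ → ℝ) (β h : ℝ) (ω : ℕ → ℝ) (N n : ℕ) : ℝ :=
  ∑ k ∈ Finset.Icc 1 N, ∑ s : Fin k → Fin (N + 1),
    if (∀ i, 1 ≤ (s i : ℕ)) ∧ (∑ i, (s i : ℕ)) = N ∧ (∃ i : Fin k, contacts s i = n) then
      Real.exp (∑ i : Fin k, (β * ω (contacts s i) + h)) * ∏ i, K (s i : ℕ)
    else 0

section Helpers

theorem aux_contacts_zero {k N : ℕ} (s : Fin k → Fin (N + 1)) (hk : 0 < k) :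
    contacts s ⟨0, hk⟩ = (s ⟨0, hk⟩ : ℕ) := by
  unfold contacts
  have : (Finset.univ.filter (fun j : Fin k => j ≤ ⟨0, hk⟩)) = {⟨0, hk⟩} := by
    ext j; simp [Fin.le_def, Fin.ext_iff]
  rw [this, Finset.sum_singleton]

theorem aux_contacts_succ {k N : ℕ} (s : Fin k → Fin (N + 1)) (i : ℕ) (hi : i + 1 < k) :
    contacts s ⟨i + 1, hi⟩ = contacts s ⟨i, by omega⟩ + (s ⟨i + 1, hi⟩ : ℕ) := by
  unfold contacts
  have : (Finset.univ.filter (fun j : Fin k => j ≤ ⟨i + 1, hi⟩)) =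
      insert ⟨i + 1, hi⟩ (Finset.univ.filter (fun j : Fin k => j ≤ ⟨i, by omega⟩)) := by
    ext j; simp [Fin.le_def, Fin.ext_iff]; omega
  rw [this, Finset.sum_insert (by simp [Fin.le_def]), add_comm]

theorem aux_contacts_mono {k N : ℕ} (s : Fin k → Fin (N + 1)) (hs : ∀ i, 1 ≤ (s i : ℕ)) :
    StrictMono (contacts s) := by
  intro i j hij
  unfold contacts
  apply Finset.sum_lt_sum_of_subset (i := j)
  · intro x; simp; intro hx; exact hx.trans hij.le
  · simp
  · simpa using hij
  · exact hs j
  · intros; omega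

theorem aux_contacts_le {k N : ℕ} (s : Fin k → Fin (N + 1)) (i : Fin k) :
    contacts s i ≤ ∑ j, (s j : ℕ) :=
  Finset.sum_le_sum_of_subset (Finset.filter_subset _ _)

theorem aux_le_contacts {k N : ℕ} (s : Fin k → Fin (N + 1)) (i : Fin k) :
    (s i : ℕ) ≤ contacts s i :=
  Finset.single_le_sum (f := fun j => (s j : ℕ)) (fun _ _ => Nat.zero_le _) (by simp)

theorem aux_contacts_last {k N : ℕ} (s : Fin k → Fin (N + 1)) (hk : 1 ≤ k) :
    contacts s ⟨k - 1, by omega⟩ = ∑ j, (s j : ℕ) := by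
  unfold contacts
  congr 1
  ext j; simp [Fin.le_def]; omega

/-- predecessor in a finite contact set (0 by default) -/
def prd (A : Finset ℕ) (a : ℕ) : ℕ := (A.filter (· < a)).sup id

/-- weight of a finite contact set -/
noncomputable def Wt (K : ℕ → ℝ) (β h : ℝ) (ω : ℕ → ℝ) (A : Finset ℕ) : ℝ :=
  ∏ a ∈ A, (Real.exp (β * ω a + h) * K (a - prd A a))

/-- admissible contact sets -/
def Vs (N : ℕ) : Finset (Finset ℕ) := (Finset.Icc 1 N).powerset.filter (N ∈ ·)

theorem prd_eq {A : Finset ℕ} {a p : ℕ} (h1 : ∀ x ∈ A, x < a → x ≤ p)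
    (h2 : p = 0 ∨ (p ∈ A ∧ p < a)) : prd A a = p := by
  unfold prd
  apply le_antisymm
  · apply Finset.sup_le; intro x hx; simp at hx; exact h1 x hx.1 hx.2
  · rcases h2 with rfl | h2
    · exact Nat.zero_le _
    · exact Finset.le_sup (f := id) (Finset.mem_filter.2 h2)

theorem prd_spec (A : Finset ℕ) (a : ℕ) :
    (∀ x ∈ A, x < a → x ≤ prd A a) ∧ (prd A a = 0 ∨ (prd A a ∈ A ∧ prd A a < a)) := by
  constructor
  · intro x hx hxa
    exact Finset.le_sup (f := id) (Finset.mem_filter.2 ⟨hx, hxa⟩)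
  · by_cases hne : (A.filter (· < a)).Nonempty
    · right
      obtain ⟨i, hi, h⟩ := Finset.exists_mem_eq_sup _ hne id
      unfold prd
      rw [h]
      simpa using hi
    · left
      rw [Finset.not_nonempty_iff_eq_empty] at hne
      simp [prd, hne]

theorem prd_zero_of {k : ℕ} (f : Fin k → ℕ) (hf : StrictMono f) (hk : 0 < k) :
    prd (Finset.univ.image f) (f ⟨0, hk⟩) = 0 := by
  apply prd_eq _ (Or.inl rfl)
  intro x hx hlt
  simp at hx
  obtain ⟨j, rfl⟩ := hx
  have := hf.lt_iff_lt.1 hlt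
  simp [Fin.lt_def] at this

theorem prd_succ_of {k : ℕ} (f : Fin k → ℕ) (hf : StrictMono f) (i : ℕ) (hi : i + 1 < k) :
    prd (Finset.univ.image f) (f ⟨i + 1, hi⟩) = f ⟨i, by omega⟩ := by
  apply prd_eq
  · intro x hx hlt
    simp at hx
    obtain ⟨j, rfl⟩ := hx
    have := hf.lt_iff_lt.1 hlt
    apply hf.monotone
    simp [Fin.lt_def, Fin.le_def] at *
    omega
  · right
    refine ⟨by simp, hf (by simp [Fin.lt_def])⟩

theorem contacts_sub_prd {k N : ℕ} (s : Fin k → Fin (N + 1)) (hs : ∀ i, 1 ≤ (s i : ℕ))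
    (i : Fin k) :
    contacts s i - prd (Finset.univ.image (contacts s)) (contacts s i) = (s i : ℕ) := by
  obtain ⟨i, hi⟩ := i
  cases i with
  | zero => rw [prd_zero_of _ (aux_contacts_mono s hs), aux_contacts_zero]; rfl
  | succ i => rw [prd_succ_of _ (aux_contacts_mono s hs), aux_contacts_succ]; omega

theorem image_inj_fn {k : ℕ} (f g : Fin k → ℕ) (hf : StrictMono f) (hg : StrictMono g)
    (h : Finset.univ.image f = Finset.univ.image g) : f = g := by
  have hr : Set.range f = Set.range g := by
    have := congrArg (fun s : Finset ℕ => (s : Set ℕ)) h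
    simpa using this
  exact (StrictMono.range_inj hf hg).1 hr

theorem exists_gaps {N : ℕ} {A : Finset ℕ} (hA : A ∈ Vs N) :
    ∃ s : Fin A.card → Fin (N + 1), (∀ i, 1 ≤ (s i : ℕ)) ∧ (∑ i, (s i : ℕ)) = N ∧
      Finset.univ.image (contacts s) = A := by
  simp only [Vs, Finset.mem_filter, Finset.mem_powerset] at hA
  obtain ⟨hsub, hN⟩ := hA
  have hIcc : ∀ x ∈ A, 1 ≤ x ∧ x ≤ N := fun x hx => Finset.mem_Icc.1 (hsub hx)
  set e : Fin A.card → ℕ := fun i => A.orderEmbOfFin rfl i with he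
  have hmono : StrictMono e := (A.orderEmbOfFin rfl).strictMono
  have hmem : ∀ i, e i ∈ A := fun i => A.orderEmbOfFin_mem rfl i
  have him : Finset.univ.image e = A := Finset.image_orderEmbOfFin_univ A rfl
  set s : Fin A.card → Fin (N + 1) := fun i => ⟨e i - prd A (e i), by
    have := (hIcc _ (hmem i)).2; omega⟩ with hs
  have hsv : ∀ i, (s i : ℕ) = e i - prd A (e i) := fun i => rfl
  have hprd : ∀ i, prd A (e i) < e i := by
    intro i
    rcases (prd_spec A (e i)).2 with h | h
    · rw [h]; exact (hIcc _ (hmem i)).1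
    · exact h.2
  have hpos : ∀ i, 1 ≤ (s i : ℕ) := by
    intro i; rw [hsv]; have := hprd i; omega
  have hc : ∀ i (hi : i < A.card), contacts s ⟨i, hi⟩ = e ⟨i, hi⟩ := by
    intro i
    induction i with
    | zero =>
      intro hi
      have := prd_zero_of e hmono hi
      rw [him] at this
      rw [aux_contacts_zero, hsv, this]; rfl
    | succ i ih =>
      intro hi
      have := prd_succ_of e hmono i hi
      rw [him] at this
      have h2 := hprd ⟨i + 1, hi⟩
      rw [aux_contacts_succ, hsv, ih, this]
      omega
  have hce : contacts s = e := funext fun ⟨i, hi⟩ => hc i hi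
  have hcard : 1 ≤ A.card := Finset.card_pos.2 ⟨N, hN⟩
  refine ⟨s, hpos, ?_, by rw [hce, him]⟩
  rw [← aux_contacts_last s hcard, hce]
  apply le_antisymm (hIcc _ (hmem _)).2
  rw [← him] at hN
  obtain ⟨j, -, hj⟩ := Finset.mem_image.1 hN
  have : e j ≤ e ⟨A.card - 1, by omega⟩ := hmono.monotone (by simp [Fin.le_def]; omega)
  omega

open Classical in
theorem sum_rewrite (K : ℕ → ℝ) (β h : ℝ) (ω : ℕ → ℝ) (N : ℕ) (P : Finset ℕ → Prop) :
    (∑ k ∈ Finset.Icc 1 N, ∑ s : Fin k → Fin (N + 1),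
      if (∀ i, 1 ≤ (s i : ℕ)) ∧ (∑ i, (s i : ℕ)) = N ∧ P (Finset.univ.image (contacts s)) then
        Real.exp (∑ i : Fin k, (β * ω (contacts s i) + h)) * ∏ i, K (s i : ℕ)
      else 0) = ∑ A ∈ (Vs N).filter P, Wt K β h ω A := by
  simp_rw [← Finset.sum_filter]
  rw [Finset.sum_sigma']
  apply Finset.sum_bij (fun x _ => Finset.univ.image (contacts x.2))
  · rintro ⟨k, s⟩ hx
    simp only [Finset.mem_sigma, Finset.mem_Icc, Finset.mem_filter, Finset.mem_univ,
      true_and] at hx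
    obtain ⟨hk, hs, hsum, hP⟩ := hx
    simp only [Vs, Finset.mem_filter, Finset.mem_powerset]
    refine ⟨⟨?_, ?_⟩, hP⟩
    · intro x hx
      obtain ⟨i, -, rfl⟩ := Finset.mem_image.1 hx
      rw [Finset.mem_Icc]
      exact ⟨(hs i).trans (aux_le_contacts s i), (aux_contacts_le s i).trans hsum.le⟩
    · exact Finset.mem_image.2 ⟨_, Finset.mem_univ _, (aux_contacts_last s hk.1).trans hsum⟩
  · rintro ⟨k, s⟩ hx ⟨k', s'⟩ hx' heq
    simp only [Finset.mem_sigma, Finset.mem_Icc, Finset.mem_filter, Finset.mem_univ,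
      true_and] at hx hx' heq
    have m1 := aux_contacts_mono s hx.2.1
    have m2 := aux_contacts_mono s' hx'.2.1
    have hkk : k = k' := by
      have := congrArg Finset.card heq
      rwa [Finset.card_image_of_injective _ m1.injective,
        Finset.card_image_of_injective _ m2.injective, Finset.card_univ, Finset.card_univ,
        Fintype.card_fin, Fintype.card_fin] at this
    subst hkk
    have hc := image_inj_fn _ _ m1 m2 heq
    have : s = s' := by
      funext i
      apply Fin.ext
      rw [← contacts_sub_prd s hx.2.1 i, ← contacts_sub_prd s' hx'.2.1 i, hc]
    rw [this]
  · intro A hA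
    rw [Finset.mem_filter] at hA
    obtain ⟨s, h1, h2, h3⟩ := exists_gaps hA.1
    refine ⟨⟨A.card, s⟩, ?_, h3⟩
    have hV := hA.1
    simp only [Vs, Finset.mem_filter, Finset.mem_powerset] at hV
    simp only [Finset.mem_sigma, Finset.mem_Icc, Finset.mem_filter, Finset.mem_univ,
      true_and]
    refine ⟨⟨Finset.card_pos.2 ⟨N, hV.2⟩, ?_⟩, h1, h2, by rw [h3]; exact hA.2⟩
    simpa using Finset.card_le_card hV.1
  · rintro ⟨k, s⟩ hx
    simp only [Finset.mem_sigma, Finset.mem_Icc, Finset.mem_filter, Finset.mem_univ,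
      true_and] at hx
    have m1 := aux_contacts_mono s hx.2.1
    unfold Wt
    rw [Finset.prod_image (fun a _ b _ hab => m1.injective hab), Finset.prod_mul_distrib,
      Real.exp_sum]
    congr 1
    apply Finset.prod_congr rfl
    intro i _
    rw [contacts_sub_prd s hx.2.1 i]

/-- Insert a point into the contact set. -/
theorem Wt_insert_le (K : ℕ → ℝ) (β h : ℝ) (ω : ℕ → ℝ) (N n : ℕ) (D : ℝ) (hn : 1 ≤ n)
    (hKpos : ∀ n, 1 ≤ n → 0 < K n)
    (hD : ∀ l m : ℕ, 1 ≤ l → 1 ≤ m → l + m ≤ N →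
      K (l + m) ≤ D * (Real.exp (β * ω n + h) * K l * K m))
    (hnN : n ≤ N) (A : Finset ℕ) (hA : A ∈ Vs N) (hnA : n ∉ A) :
    Wt K β h ω A ≤ D * Wt K β h ω (insert n A) := by
  simp only [Vs, Finset.mem_filter, Finset.mem_powerset] at hA
  obtain ⟨hsub, hN⟩ := hA
  have hIcc : ∀ x ∈ A, 1 ≤ x ∧ x ≤ N := fun x hx => Finset.mem_Icc.1 (hsub hx)
  have hne : (A.filter (n < ·)).Nonempty := ⟨N, Finset.mem_filter.2 ⟨hN, by
    rcases hnN.lt_or_eq with h | h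
    · exact h
    · subst h; exact absurd hN hnA⟩⟩
  set b := (A.filter (n < ·)).min' hne with hb
  have hbm := Finset.min'_mem _ hne
  rw [← hb, Finset.mem_filter] at hbm
  obtain ⟨hbA, hnb⟩ := hbm
  have hbmin : ∀ x ∈ A, n < x → b ≤ x := fun x hx hlt =>
    Finset.min'_le _ _ (Finset.mem_filter.2 ⟨hx, hlt⟩)
  obtain ⟨p1, p2⟩ := prd_spec A n
  set p := prd A n with hp
  have hpn : p < n := by rcases p2 with h | h <;> omega
  have hAb : prd A b = p := by
    apply prd_eq
    · intro x hx hxb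
      apply p1 x hx
      by_contra hcon
      have : x ≠ n := fun h => hnA (h ▸ hx)
      have := hbmin x hx (by omega)
      omega
    · rcases p2 with h | h
      · exact Or.inl h
      · exact Or.inr ⟨h.1, by omega⟩
  have hIn : prd (insert n A) n = p := by
    apply prd_eq
    · intro x hx hxn
      rcases Finset.mem_insert.1 hx with h | h
      · omega
      · exact p1 x h hxn
    · rcases p2 with h | h
      · exact Or.inl h
      · exact Or.inr ⟨Finset.mem_insert_of_mem h.1, h.2⟩
  have hIb : prd (insert n A) b = n := by
    apply prd_eq
    · intro x hx hxb
      rcases Finset.mem_insert.1 hx with h | h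
      · omega
      · by_contra hcon
        have := hbmin x h (by omega)
        omega
    · exact Or.inr ⟨Finset.mem_insert_self _ _, hnb⟩
  have hother : ∀ x ∈ A.erase b, prd (insert n A) x = prd A x := by
    intro x hx
    rw [Finset.mem_erase] at hx
    obtain ⟨q1, q2⟩ := prd_spec A x
    have hxn : x ≠ n := fun h => hnA (h ▸ hx.2)
    apply prd_eq
    · intro y hy hyx
      rcases Finset.mem_insert.1 hy with h | h
      · have h1 := hbmin x hx.2 (by omega)
        have := q1 b hbA (lt_of_le_of_ne h1 (Ne.symm hx.1))
        omega
      · exact q1 y h hyx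
    · rcases q2 with h | h
      · exact Or.inl h
      · exact Or.inr ⟨Finset.mem_insert_of_mem h.1, h.2⟩
  unfold Wt
  rw [Finset.prod_insert hnA, ← Finset.mul_prod_erase A _ hbA, ← Finset.mul_prod_erase A _ hbA,
    hIn, hIb, hAb]
  rw [Finset.prod_congr rfl (g := fun a => Real.exp (β * ω a + h) * K (a - prd A a))
    (s₁ := A.erase b) (f := fun a => Real.exp (β * ω a + h) * K (a - prd (insert n A) a))
    (fun x hx => by rw [hother x hx])]
  set R := ∏ a ∈ A.erase b, Real.exp (β * ω a + h) * K (a - prd A a) with hR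
  have hRpos : 0 ≤ R := by
    apply Finset.prod_nonneg
    intro x hx
    rw [Finset.mem_erase] at hx
    have : prd A x < x := by
      have := (hIcc x hx.2).1
      rcases (prd_spec A x).2 with h | h <;> omega
    exact mul_nonneg (Real.exp_pos _).le (hKpos _ (by omega)).le
  have hkey := hD (n - p) (b - n) (by omega) (by omega) (by have := (hIcc b hbA).2; omega)
  have e1 : n - p + (b - n) = b - p := by omega
  rw [e1] at hkey
  calc Real.exp (β * ω b + h) * K (b - p) * R = (Real.exp (β * ω b + h) * R) * K (b - p) := by ring
    _ ≤ (Real.exp (β * ω b + h) * R) * (D * (Real.exp (β * ω n + h) * K (n - p) * K (b - n))) :=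
      mul_le_mul_of_nonneg_left hkey (mul_nonneg (Real.exp_pos _).le hRpos)
    _ = _ := by ring

theorem Wt_nonneg (K : ℕ → ℝ) (β h : ℝ) (ω : ℕ → ℝ) (N : ℕ)
    (hKpos : ∀ n, 1 ≤ n → 0 < K n) (A : Finset ℕ) (hA : A ∈ Vs N) : 0 ≤ Wt K β h ω A := by
  simp only [Vs, Finset.mem_filter, Finset.mem_powerset] at hA
  apply Finset.prod_nonneg
  intro x hx
  have h1 := (Finset.mem_Icc.1 (hA.1 hx)).1
  have : prd A x < x := by
    rcases (prd_spec A x).2 with h | h <;> omega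
  exact mul_nonneg (Real.exp_pos _).le (hKpos _ (by omega)).le

theorem pin_step (K : ℕ → ℝ) (β h : ℝ) (ω : ℕ → ℝ) (N n : ℕ) (D : ℝ) (hn : 1 ≤ n)
    (hKpos : ∀ n, 1 ≤ n → 0 < K n)
    (hD : ∀ l m : ℕ, 1 ≤ l → 1 ≤ m → l + m ≤ N →
      K (l + m) ≤ D * (Real.exp (β * ω n + h) * K l * K m))
    (hD0 : 0 ≤ D)
    (hnN : n ≤ N) (S : Finset ℕ) :
    ∑ A ∈ (Vs N).filter (S ⊆ ·), Wt K β h ω A ≤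
      (1 + D) * ∑ A ∈ (Vs N).filter (insert n S ⊆ ·), Wt K β h ω A := by
  rw [← Finset.sum_filter_add_sum_filter_not ((Vs N).filter (S ⊆ ·)) (n ∈ ·), add_mul, one_mul]
  have e : ((Vs N).filter (S ⊆ ·)).filter (n ∈ ·) = (Vs N).filter (insert n S ⊆ ·) := by
    ext A; simp only [Finset.mem_filter, Finset.insert_subset_iff]; tauto
  rw [e]
  gcongr
  calc _ ≤ ∑ A ∈ ((Vs N).filter (S ⊆ ·)).filter (n ∉ ·), D * Wt K β h ω (insert n A) := by
        apply Finset.sum_le_sum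
        intro A hA
        simp only [Finset.mem_filter] at hA
        exact Wt_insert_le K β h ω N n D hn hKpos hD hnN A hA.1.1 hA.2
    _ = D * ∑ A ∈ ((Vs N).filter (S ⊆ ·)).filter (n ∉ ·), Wt K β h ω (insert n A) := by
        rw [Finset.mul_sum]
    _ ≤ _ := by
        apply mul_le_mul_of_nonneg_left _ hD0
        rw [← Finset.sum_image (f := Wt K β h ω) (g := insert n)
          (s := ((Vs N).filter (S ⊆ ·)).filter (n ∉ ·))]
        · apply Finset.sum_le_sum_of_subset_of_nonneg
          · intro B hB
            obtain ⟨A, hA, rfl⟩ := Finset.mem_image.1 hB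
            simp only [Finset.mem_filter, Vs, Finset.mem_powerset] at hA ⊢
            refine ⟨⟨?_, Finset.mem_insert_of_mem hA.1.1.2⟩, Finset.insert_subset_insert _ hA.1.2⟩
            exact Finset.insert_subset (Finset.mem_Icc.2 ⟨hn, hnN⟩) hA.1.1.1
          · intro A hA _
            exact Wt_nonneg K β h ω N hKpos A (Finset.mem_filter.1 hA).1
        · intro A hA B hB hAB
          have hA' := (Finset.mem_filter.1 hA).2
          have hB' := (Finset.mem_filter.1 hB).2
          have := congrArg (fun s => Finset.erase s n) hAB
          simpa [Finset.erase_insert hA', Finset.erase_insert hB'] using this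

theorem pin_iter (K : ℕ → ℝ) (β h : ℝ) (ω : ℕ → ℝ) (N : ℕ) (D : ℝ)
    (hKpos : ∀ n, 1 ≤ n → 0 < K n)
    (hD : ∀ n l m : ℕ, 1 ≤ l → 1 ≤ m → l + m ≤ N →
      K (l + m) ≤ D * (Real.exp (β * ω n + h) * K l * K m))
    (hD0 : 0 ≤ D) (S : Finset ℕ) (hS : ∀ n ∈ S, 1 ≤ n ∧ n ≤ N) :
    ∑ A ∈ (Vs N).filter ((∅ : Finset ℕ) ⊆ ·), Wt K β h ω A ≤
      (1 + D) ^ S.card * ∑ A ∈ (Vs N).filter (S ⊆ ·), Wt K β h ω A := by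
  induction S using Finset.induction_on with
  | empty => simp
  | insert n S hnS ih =>
    have h1 := hS n (Finset.mem_insert_self _ _)
    have h2 := ih (fun x hx => hS x (Finset.mem_insert_of_mem hx))
    have h3 := pin_step K β h ω N n D h1.1 hKpos (hD n) hD0 h1.2 S
    rw [Finset.card_insert_of_notMem hnS, pow_succ, mul_assoc]
    exact h2.trans (mul_le_mul_of_nonneg_left h3 (by positivity))

theorem Zq_eq_s12 (K : ℕ → ℝ) (β h : ℝ) (ω : ℕ → ℝ) (N : ℕ) :
    Zq K β h ω N = ∑ A ∈ (Vs N).filter ((∅ : Finset ℕ) ⊆ ·), Wt K β h ω A := by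
  have := sum_rewrite K β h ω N ((∅ : Finset ℕ) ⊆ ·)
  simp only [Finset.empty_subset, and_true] at this
  simp only [Finset.empty_subset]
  unfold Zq
  convert this

theorem Zpin_eq (K : ℕ → ℝ) (β h : ℝ) (ω : ℕ → ℝ) (N n : ℕ) :
    Zpin K β h ω N n = ∑ A ∈ (Vs N).filter (insert n (∅ : Finset ℕ) ⊆ ·), Wt K β h ω A := by
  have := sum_rewrite K β h ω N (insert n (∅ : Finset ℕ) ⊆ ·)
  unfold Zpin
  convert this using 7
  simp

theorem Zc_eq (K : ℕ → ℝ) (β h : ℝ) (ω : ℕ → ℝ) (N : ℕ) :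
    Zc K β h ω N = ∑ A ∈ (Vs N).filter ((changeSet ω N).image (· - 1) ⊆ ·), Wt K β h ω A := by
  have := sum_rewrite K β h ω N ((changeSet ω N).image (· - 1) ⊆ ·)
  unfold Zc
  convert this using 7
  simp [Finset.image_subset_iff]

end Helpers

section Analytic

theorem potter_aux (f : ℕ → ℝ) (δ : ℝ) (hδ : 0 < δ) (hf : ∀ n, 1 ≤ n → 0 < f n)
    (h : ∀ᶠ n in atTop, f n ≤ (2 : ℝ) ^ δ * f (n / 2)) :
    ∃ C : ℝ, 0 < C ∧ ∀ n : ℕ, 1 ≤ n → f n ≤ C * (n : ℝ) ^ δ := by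
  obtain ⟨n0, hn0⟩ := eventually_atTop.1 h
  have hC : 0 < ∑ j ∈ Finset.range (n0 + 2), |f j| + 1 := by positivity
  refine ⟨∑ j ∈ Finset.range (n0 + 2), |f j| + 1, hC, ?_⟩
  set C := ∑ j ∈ Finset.range (n0 + 2), |f j| + 1 with hCdef
  intro n
  induction n using Nat.strong_induction_on with
  | _ n ih =>
    intro hn
    by_cases hlt : n < n0 + 2
    · have h1 : |f n| ≤ ∑ j ∈ Finset.range (n0 + 2), |f j| :=
        Finset.single_le_sum (f := fun j => |f j|) (fun _ _ => abs_nonneg _)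
          (Finset.mem_range.2 hlt)
      have h2 : (1 : ℝ) ≤ (n : ℝ) ^ δ := Real.one_le_rpow (by exact_mod_cast hn) hδ.le
      have h3 := le_abs_self (f n)
      nlinarith
    · have h1 := hn0 n (by omega)
      have h2 := ih (n / 2) (by omega) (by omega)
      have h3 : (2 : ℝ) ^ δ * ((n / 2 : ℕ) : ℝ) ^ δ ≤ (n : ℝ) ^ δ := by
        rw [← Real.mul_rpow (by norm_num) (Nat.cast_nonneg _)]
        apply Real.rpow_le_rpow (by positivity) _ hδ.le
        have : 2 * (n / 2) ≤ n := by omega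
        exact_mod_cast this
      have h4 : (0 : ℝ) < 2 ^ δ := by positivity
      calc f n ≤ 2 ^ δ * f (n / 2) := h1
        _ ≤ 2 ^ δ * (C * ((n / 2 : ℕ) : ℝ) ^ δ) := by gcongr
        _ = C * (2 ^ δ * ((n / 2 : ℕ) : ℝ) ^ δ) := by ring
        _ ≤ C * (n : ℝ) ^ δ := by gcongr

theorem potter (L : ℕ → ℝ)
    (hL : Tendsto (fun n : ℕ => L ⌊(1 / 2 : ℝ) * (n : ℝ)⌋₊ / L n) atTop (𝓝 1))
    (hpos : ∀ n, 1 ≤ n → 0 < L n) (δ : ℝ) (hδ : 0 < δ) :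
    ∃ C : ℝ, 0 < C ∧ ∀ n : ℕ, 1 ≤ n → L n ≤ C * (n : ℝ) ^ δ ∧ 1 ≤ C * (n : ℝ) ^ δ * L n := by
  have hfl : ∀ n : ℕ, ⌊(1 / 2 : ℝ) * (n : ℝ)⌋₊ = n / 2 := by
    intro n
    rw [show (1 / 2 : ℝ) * (n : ℝ) = (n : ℝ) / ((2 : ℕ) : ℝ) by push_cast; ring]
    exact Nat.floor_div_eq_div n 2
  simp_rw [hfl] at hL
  have hr : (1 : ℝ) < 2 ^ δ := Real.one_lt_rpow (by norm_num) hδ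
  have hr0 : (0 : ℝ) < 2 ^ δ := by positivity
  have e1 := hL.eventually (lt_mem_nhds (inv_lt_one_of_one_lt₀ hr))
  have e2 := hL.eventually (gt_mem_nhds hr)
  obtain ⟨C1, hC1, h1⟩ := potter_aux L δ hδ hpos (by
    filter_upwards [e1, eventually_ge_atTop 2] with n hn hn2
    have := hpos n (by omega)
    rw [lt_div_iff₀ this, inv_mul_lt_iff₀ hr0] at hn
    exact hn.le)
  obtain ⟨C2, hC2, h2⟩ := potter_aux (fun n => (L n)⁻¹) δ hδ (fun n hn => inv_pos.2 (hpos n hn)) (by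
    filter_upwards [e2, eventually_ge_atTop 2] with n hn hn2
    have p1 := hpos n (by omega)
    have p2 := hpos (n / 2) (by omega)
    rw [div_lt_iff₀ p1] at hn
    rw [← div_eq_mul_inv, le_div_iff₀ p2, inv_mul_le_iff₀ p1]
    linarith)
  refine ⟨C1 + C2, by positivity, fun n hn => ?_⟩
  have hnp : (0 : ℝ) ≤ (n : ℝ) ^ δ := by positivity
  have hLn := hpos n hn
  constructor
  · have := h1 n hn
    nlinarith
  · have h3 := h2 n hn
    rw [inv_le_iff_one_le_mul₀ hLn] at h3
    have : 0 ≤ C1 * (n : ℝ) ^ δ * L n := by positivity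
    nlinarith

theorem K_split (α : ℝ) (hα : 0 ≤ α) (L K : ℕ → ℝ)
    (hL : ∀ c : ℝ, 0 < c →
      Tendsto (fun n : ℕ => L ⌊c * (n : ℝ)⌋₊ / L n) atTop (𝓝 1))
    (hKL : ∀ n : ℕ, 1 ≤ n → K n = L n * (n : ℝ) ^ (-(1 + α)))
    (hKpos : ∀ n, 1 ≤ n → 0 < K n) (ς : ℝ) (hς : 0 < ς) :
    ∃ C : ℝ, 0 < C ∧ ∀ N l m : ℕ, 1 ≤ l → 1 ≤ m → l + m ≤ N →
      K (l + m) ≤ C * (N : ℝ) ^ (2 + α + ς) * (K l * K m) := by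
  have hpos : ∀ n, 1 ≤ n → 0 < L n := by
    intro n hn
    have h1 := hKpos n hn
    rw [hKL n hn] at h1
    have hn' : (0 : ℝ) < n := by exact_mod_cast hn
    exact (pos_iff_pos_of_mul_pos h1).2 (by positivity)
  obtain ⟨C, hC, hP⟩ := potter L (hL (1 / 2) (by norm_num)) hpos (ς / 3) (by positivity)
  refine ⟨C ^ 3, by positivity, ?_⟩
  intro N l m hl hm hlm
  have hl' : (0 : ℝ) < l := by exact_mod_cast hl
  have hm' : (0 : ℝ) < m := by exact_mod_cast hm
  have hN1 : (1 : ℝ) ≤ N := by exact_mod_cast (by omega : 1 ≤ N)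
  have hN' : (0 : ℝ) < N := by linarith
  have hlN : (l : ℝ) ≤ N := by exact_mod_cast (by omega : l ≤ N)
  have hmN : (m : ℝ) ≤ N := by exact_mod_cast (by omega : m ≤ N)
  have hlmN : ((l + m : ℕ) : ℝ) ≤ N := by exact_mod_cast hlm
  set T := (N : ℝ) ^ (ς / 3) with hT
  have hTp : 0 < T := by positivity
  have mono : ∀ x : ℕ, (x : ℝ) ≤ N → (x : ℝ) ^ (ς / 3) ≤ T := fun x hx =>
    Real.rpow_le_rpow (Nat.cast_nonneg _) hx (by positivity)
  have a1 : L (l + m) ≤ C * T :=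
    (hP (l + m) (by omega)).1.trans (by have := mono _ hlmN; gcongr)
  have lo : ∀ x : ℕ, 1 ≤ x → (x : ℝ) ≤ N → 1 ≤ C * T * L x := by
    intro x hx hxN
    have := mono x hxN
    have hLx := hpos x hx
    exact (hP x hx).2.trans (by gcongr)
  have a2 := lo l hl hlN
  have a3 := lo m hm hmN
  have hLl := hpos l hl
  have hLm := hpos m hm
  set p := 1 + α with hp
  have hp0 : 0 < p := by linarith
  have a4 : ((l + m : ℕ) : ℝ) ^ (-p) ≤ (N : ℝ) ^ p * ((l : ℝ) ^ (-p) * (m : ℝ) ^ (-p)) := by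
    have hlmp : (0 : ℝ) < ((l + m : ℕ) : ℝ) := by exact_mod_cast (by omega : 0 < l + m)
    rw [Real.rpow_neg hlmp.le, Real.rpow_neg hl'.le, Real.rpow_neg hm'.le, ← mul_inv,
      ← Real.mul_rpow hl'.le hm'.le, ← div_eq_mul_inv, le_div_iff₀ (by positivity),
      inv_mul_le_iff₀ (by positivity), ← Real.mul_rpow hlmp.le hN'.le]
    apply Real.rpow_le_rpow (by positivity) _ hp0.le
    push_cast
    nlinarith
  have a5 : T ^ 3 * (N : ℝ) ^ p ≤ (N : ℝ) ^ (2 + α + ς) := by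
    rw [hT, ← Real.rpow_natCast, ← Real.rpow_mul hN'.le, ← Real.rpow_add hN']
    apply Real.rpow_le_rpow_of_exponent_le hN1
    push_cast
    linarith
  rw [hKL _ (by omega : 1 ≤ l + m), hKL l hl, hKL m hm]
  set kl := (l : ℝ) ^ (-p)
  set km := (m : ℝ) ^ (-p)
  have hkl : 0 < kl := by positivity
  have hkm : 0 < km := by positivity
  have a6 : C * T ≤ C * T * ((C * T * L l) * (C * T * L m)) := by
    have : 1 ≤ (C * T * L l) * (C * T * L m) := one_le_mul_of_one_le_of_one_le a2 a3
    have h0 : 0 < C * T := by positivity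
    nlinarith
  calc L (l + m) * ((l + m : ℕ) : ℝ) ^ (-p)
      ≤ (C * T * ((C * T * L l) * (C * T * L m))) * ((N : ℝ) ^ p * (kl * km)) := by
        apply mul_le_mul (a1.trans a6) a4 (by positivity) (by positivity)
    _ = (C ^ 3 * (L l * kl * (L m * km))) * (T ^ 3 * (N : ℝ) ^ p) := by ring
    _ ≤ (C ^ 3 * (L l * kl * (L m * km))) * (N : ℝ) ^ (2 + α + ς) := by gcongr
    _ = _ := by ring

end Analytic

/-- For every `β ≥ 0`, `h` and `ς > 0` there is `C > 0` such
that for all `N ≥ 1`, all `±1`-valued `ω` and all `1 ≤ n ≤ N`,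
`Z_{N,β,h,ω} ≤ (1 + C N^{2+α+ς}) Z^{(n)}_{N,β,h,ω}`; consequently
`Z_{N,β,h,ω} ≤ (1 + C N^{2+α+ς})^{B_N} Z^c_{N,β,h,ω}`. -/
theorem statement12 (α : ℝ) (hα : 0 ≤ α) (L K : ℕ → ℝ)
    (hL : ∀ c : ℝ, 0 < c →
      Tendsto (fun n : ℕ => L ⌊c * (n : ℝ)⌋₊ / L n) atTop (𝓝 1))
    (hKL : ∀ n : ℕ, 1 ≤ n → K n = L n * (n : ℝ) ^ (-(1 + α)))
    (hKpos : ∀ n, 1 ≤ n → 0 < K n) (hKsum : ∑' n : ℕ, K (n + 1) = 1)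
    (β h : ℝ) (hβ : 0 ≤ β) (ς : ℝ) (hς : 0 < ς) :
    ∃ C : ℝ, 0 < C ∧ ∀ N : ℕ, 1 ≤ N → ∀ ω : ℕ → ℝ, (∀ n, ω n = 1 ∨ ω n = -1) →
      (∀ n : ℕ, 1 ≤ n → n ≤ N →
        Zq K β h ω N ≤ (1 + C * (N : ℝ) ^ (2 + α + ς)) * Zpin K β h ω N n) ∧
      Zq K β h ω N ≤ (1 + C * (N : ℝ) ^ (2 + α + ς)) ^ (BN ω N) * Zc K β h ω N := by
  obtain ⟨C, hC, hsplit⟩ := K_split α hα L K hL hKL hKpos ς hς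
  refine ⟨C * Real.exp (β - h), by positivity, ?_⟩
  intro N hN ω hω
  set D := C * Real.exp (β - h) * (N : ℝ) ^ (2 + α + ς) with hDdef
  have hD0 : 0 ≤ D := by positivity
  have hD : ∀ n l m : ℕ, 1 ≤ l → 1 ≤ m → l + m ≤ N →
      K (l + m) ≤ D * (Real.exp (β * ω n + h) * K l * K m) := by
    intro n l m hl hm hlm
    have hexp : 1 ≤ Real.exp (β - h) * Real.exp (β * ω n + h) := by
      rw [← Real.exp_add]
      apply Real.one_le_exp
      rcases hω n with h1 | h1 <;> rw [h1] <;> linarith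
    have hKl := hKpos l hl
    have hKm := hKpos m hm
    have h0 : 0 ≤ C * (N : ℝ) ^ (2 + α + ς) * (K l * K m) := by positivity
    calc K (l + m) ≤ C * (N : ℝ) ^ (2 + α + ς) * (K l * K m) := hsplit N l m hl hm hlm
      _ ≤ C * (N : ℝ) ^ (2 + α + ς) * (K l * K m) *
          (Real.exp (β - h) * Real.exp (β * ω n + h)) := le_mul_of_one_le_right h0 hexp
      _ = _ := by rw [hDdef]; ring
  constructor
  · intro n hn hnN
    rw [Zq_eq_s12, Zpin_eq]
    exact pin_step K β h ω N n D hn hKpos (hD n) hD0 hnN ∅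
  · have hm : ∀ m ∈ changeSet ω N, 2 ≤ m ∧ m ≤ N + 1 := by
      intro m hm
      exact Finset.mem_Icc.1 (Finset.mem_filter.1 hm).1
    have hcard : ((changeSet ω N).image (· - 1)).card = BN ω N := by
      apply Finset.card_image_of_injOn
      intro a ha b hb hab
      have h1 := hm a ha
      have h2 := hm b hb
      simp only at hab
      omega
    rw [Zq_eq_s12, Zc_eq, ← hcard]
    apply pin_iter K β h ω N D hKpos hD hD0
    intro n hn
    obtain ⟨m, hm', rfl⟩ := Finset.mem_image.1 hn
    have := hm m hm'
    omega
end

section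
/- For every sequence ω taking values in {−1,+1}, every β ≥ 0, h ∈ ℝ and N ≥ 1, the constrained partition function factorizes over the strips: Z^c_{N,β,h,ω} = ( ∏_{i=1}^{B_N} Z_{l_i, β ω_{L_{i−1}+1} + h} ) · Z_{N − L_{B_N}, β ω_{L_{B_N}+1} + h}, with the convention Z_{0,u} = 1. -/
open Filter Topology

/-- Sum over `k`-step chains from `a` to `b` of products of jump weights. -/
noncomputable def chainSum (g : ℕ → ℕ → ℝ) : ℕ → ℕ → ℕ → ℝ
  | 0, a, b => if a = b then 1 else 0
  | (k+1), a, b => ∑ c ∈ Finset.Ioc a b, g a c * chainSum g k c b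

/-- Green function. -/
noncomputable def green (g : ℕ → ℕ → ℝ) (a b : ℕ) : ℝ :=
  ∑ k ∈ Finset.range (b - a + 1), chainSum g k a b

lemma chainSum_eq_zero (g : ℕ → ℕ → ℝ) (k : ℕ) : ∀ a b, b - a < k → chainSum g k a b = 0 := by
  induction k with
  | zero => intro a b h; omega
  | succ k ih =>
    intro a b h
    rw [chainSum]
    apply Finset.sum_eq_zero
    intro c hc
    rw [Finset.mem_Ioc] at hc
    rw [ih c b (by omega), mul_zero]

lemma green_eq_of_lt (g : ℕ → ℕ → ℝ) (a b R : ℕ) (hR : b - a < R) :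
    ∑ k ∈ Finset.range R, chainSum g k a b = green g a b := by
  symm
  apply Finset.sum_subset
  · intro x hx
    simp only [Finset.mem_range] at *
    omega
  · intro x _ hx2
    apply chainSum_eq_zero
    simp only [Finset.mem_range] at hx2
    omega

lemma green_self (g : ℕ → ℕ → ℝ) (a : ℕ) : green g a a = 1 := by
  simp [green, chainSum]

lemma green_rec (g : ℕ → ℕ → ℝ) (a b : ℕ) (hab : a < b) :
    green g a b = ∑ c ∈ Finset.Ioc a b, g a c * green g c b := by
  rw [← green_eq_of_lt g a b (b + 1 + 1) (by omega), Finset.sum_range_succ']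
  have h0 : chainSum g 0 a b = 0 := by
    rw [chainSum, if_neg (by omega)]
  rw [h0, add_zero]
  simp only [chainSum]
  rw [Finset.sum_comm]
  apply Finset.sum_congr rfl
  intro c hc
  rw [← Finset.mul_sum, green_eq_of_lt g c b (b+1) (by omega)]

lemma green_factor (g : ℕ → ℕ → ℝ) (m b : ℕ) (hmb : m ≤ b)
    (hg : ∀ x y, x < m → m < y → g x y = 0) :
    ∀ n a, m - a = n → a ≤ m → green g a b = green g a m * green g m b := by
  intro n
  induction n using Nat.strong_induction_on with
  | _ n ih =>
    intro a hn ham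
    rcases Nat.eq_or_lt_of_le ham with h | h
    · subst h; rw [green_self, one_mul]
    · rw [green_rec g a b (by omega), green_rec g a m h, Finset.sum_mul]
      symm
      have : ∀ c ∈ Finset.Ioc a m, g a c * green g c m * green g m b = g a c * green g c b := by
        intro c hc
        rw [Finset.mem_Ioc] at hc
        rw [ih (m - c) (by omega) c rfl hc.2, mul_assoc]
      rw [Finset.sum_congr rfl this]
      apply Finset.sum_subset
      · intro x hx
        simp only [Finset.mem_Ioc] at *
        omega
      · intro x hx hx2
        simp only [Finset.mem_Ioc] at *
        rw [hg a x h (by omega), zero_mul]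

lemma chainSum_shift (g g' : ℕ → ℕ → ℝ) (a n : ℕ)
    (hg : ∀ x y, x < y → y ≤ n → g (a + x) (a + y) = g' x y) (k : ℕ) :
    ∀ x, chainSum g k (a + x) (a + n) = chainSum g' k x n := by
  induction k with
  | zero => intro x; simp [chainSum]
  | succ k ih =>
    intro x
    rw [chainSum, chainSum]
    symm
    apply Finset.sum_bij (fun c _ => a + c)
    · intro c hc; simp only [Finset.mem_Ioc] at *; omega
    · intro c _ d _ h; omega
    · intro c hc
      simp only [Finset.mem_Ioc] at hc
      exact ⟨c - a, by simp only [Finset.mem_Ioc]; omega, by omega⟩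
    · intro c hc
      simp only [Finset.mem_Ioc] at hc
      rw [ih, hg x c hc.1 hc.2]

open Classical in
/-- Jump weights with prohibition of jumping over points of `C`. -/
noncomputable def jumpW (K f : ℕ → ℝ) (C : Finset ℕ) (a c : ℕ) : ℝ :=
  if ∃ m ∈ C, a < m ∧ m < c then 0 else Real.exp (f c) * K (c - a)

lemma contacts_cons_zero {k M : ℕ} (x : Fin (M+1)) (s : Fin k → Fin (M + 1)) :
    contacts (Fin.cons x s : Fin (k+1) → Fin (M+1)) 0 = x := by
  simp [contacts, Finset.sum_filter, Fin.sum_univ_succ]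

lemma contacts_cons_succ {k M : ℕ} (x : Fin (M+1)) (s : Fin k → Fin (M + 1)) (i : Fin k) :
    contacts (Fin.cons x s : Fin (k+1) → Fin (M+1)) i.succ = x + contacts s i := by
  simp [contacts, Finset.sum_filter, Fin.sum_univ_succ]

/-- admissibility -/
def adm (C : Finset ℕ) (b M k a : ℕ) (s : Fin k → Fin (M + 1)) : Prop :=
  (∀ i, 1 ≤ (s i : ℕ)) ∧ a + (∑ i, (s i : ℕ)) = b ∧
    (∀ c ∈ C, a < c → ∃ i : Fin k, a + contacts s i = c)

lemma adm_cons (C : Finset ℕ) (b M k a : ℕ) (x : Fin (M+1)) (s : Fin k → Fin (M + 1)) :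
    adm C b M (k+1) a (Fin.cons x s : Fin (k+1) → Fin (M+1)) ↔
      1 ≤ (x : ℕ) ∧ (¬ ∃ m ∈ C, a < m ∧ m < a + x) ∧ adm C b M k (a + x) s := by
  unfold adm
  simp only [Fin.forall_fin_succ, Fin.exists_fin_succ, contacts_cons_zero, contacts_cons_succ,
    Fin.sum_univ_succ, Fin.cons_zero, Fin.cons_succ]
  constructor
  · rintro ⟨⟨h1, h2⟩, h3, h4⟩
    refine ⟨h1, ?_, h2, by omega, ?_⟩
    · rintro ⟨m, hm, ham, hmx⟩
      rcases h4 m hm ham with h | ⟨i, hi⟩ <;> omega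
    · intro c hc hac
      rcases h4 c hc (by omega) with h | ⟨i, hi⟩
      · omega
      · exact ⟨i, by omega⟩
  · rintro ⟨h1, h2, h3, h4, h5⟩
    refine ⟨⟨h1, h3⟩, by omega, ?_⟩
    intro c hc hac
    rcases lt_trichotomy c (a + x) with h | h | h
    · exact absurd ⟨c, hc, hac, h⟩ h2
    · left; omega
    · obtain ⟨i, hi⟩ := h5 c hc h
      exact Or.inr ⟨i, by omega⟩

open Classical in
lemma sum_eq_chainSum (K f : ℕ → ℝ) (C : Finset ℕ) (b M : ℕ) (hC : ∀ c ∈ C, c ≤ b) (k : ℕ) :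
    ∀ a, b ≤ a + M → (∑ s : Fin k → Fin (M + 1),
      if adm C b M k a s then
        Real.exp (∑ i : Fin k, f (a + contacts s i)) * ∏ i, K (s i : ℕ) else 0) =
      chainSum (jumpW K f C) k a b := by
  induction k with
  | zero =>
    intro a ha
    rw [chainSum]
    have : ∀ s : Fin 0 → Fin (M+1), adm C b M 0 a s ↔ a = b := by
      intro s
      simp only [adm, IsEmpty.forall_iff, Finset.univ_eq_empty, Finset.sum_empty, add_zero,
        IsEmpty.exists_iff, true_and]
      constructor
      · exact fun h => h.1
      · intro h
        refine ⟨h, fun c hc hac => ?_⟩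
        have := hC c hc
        omega
    simp [this]
  | succ k ih =>
    intro a ha
    rw [chainSum, ← (Fin.consEquiv (fun _ : Fin (k+1) => Fin (M+1))).sum_comp,
      Fintype.sum_prod_type]
    have key : ∀ x : Fin (M+1), (∑ s : Fin k → Fin (M+1),
        if adm C b M (k+1) a (Fin.cons x s : Fin (k+1) → Fin (M+1)) then
          Real.exp (∑ i : Fin (k+1), f (a + contacts (Fin.cons x s : Fin (k+1) → Fin (M+1)) i)) *
            ∏ i, K ((Fin.cons x s : Fin (k+1) → Fin (M+1)) i : ℕ) else 0) =
        if 1 ≤ (x : ℕ) then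
          jumpW K f C a (a + x) * chainSum (jumpW K f C) k (a + x) b else 0 := by
      intro x
      rw [← ih (a + x) (by omega)]
      simp only [adm_cons, contacts_cons_zero, contacts_cons_succ,
        Fin.sum_univ_succ, Fin.prod_univ_succ, Fin.cons_zero, Fin.cons_succ]
      by_cases h1 : 1 ≤ (x : ℕ)
      · by_cases h2 : ∃ m ∈ C, a < m ∧ m < a + x
        · simp [jumpW, h2]
        · rw [jumpW, if_neg h2, if_pos h1, Finset.mul_sum]
          apply Finset.sum_congr rfl
          intro s _
          by_cases h3 : adm C b M k (a + x) s
          · rw [if_pos ⟨h1, h2, h3⟩, if_pos h3, Real.exp_add]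
            simp only [add_assoc, Nat.add_sub_cancel_left]
            ring
          · rw [if_neg (fun h => h3 h.2.2), if_neg h3, mul_zero]
      · simp [h1]
    refine (Finset.sum_congr rfl (fun x _ => key x)).trans ?_
    rw [← Finset.sum_filter]
    symm
    apply Finset.sum_bij_ne_zero (fun c hc _ => (Fin.ofNat (M+1) (c - a)))
    · intro c hc _
      simp only [Finset.mem_Ioc] at hc
      simp only [Finset.mem_filter, Finset.mem_univ, true_and, Fin.val_ofNat]
      rw [Nat.mod_eq_of_lt (by omega)]; omega
    · intro c hc _ d hd _ h
      simp only [Finset.mem_Ioc] at hc hd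
      have := congrArg Fin.val h
      simp only [Fin.val_ofNat] at this
      rw [Nat.mod_eq_of_lt (by omega), Nat.mod_eq_of_lt (by omega)] at this
      omega
    · intro x hx hne
      simp only [Finset.mem_filter, Finset.mem_univ, true_and] at hx
      have hxb : a + (x : ℕ) ≤ b := by
        by_contra hcon
        apply hne
        have : chainSum (jumpW K f C) k (a + x) b = 0 := by
          cases k with
          | zero => rw [chainSum, if_neg (by omega)]
          | succ k => rw [chainSum, Finset.Ioc_eq_empty (by omega), Finset.sum_empty]
        rw [this, mul_zero]
      refine ⟨a + x, by simp only [Finset.mem_Ioc]; omega, hne, ?_⟩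
      apply Fin.ext
      simp only [Fin.val_ofNat]
      rw [Nat.mod_eq_of_lt (by omega)]; omega
    · intro c hc _
      simp only [Finset.mem_Ioc] at hc
      simp only [Fin.val_ofNat]
      rw [Nat.mod_eq_of_lt (by omega), Nat.add_sub_cancel' (by omega)]

lemma sum_Icc_eq_green (g : ℕ → ℕ → ℝ) (N : ℕ) (hN : 1 ≤ N) :
    ∑ k ∈ Finset.Icc 1 N, chainSum g k 0 N = green g 0 N := by
  rw [green, Nat.sub_zero]
  apply Finset.sum_subset
  · intro x hx
    simp only [Finset.mem_Icc, Finset.mem_range] at *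
    omega
  · intro x hx hx2
    simp only [Finset.mem_Icc, Finset.mem_range] at *
    have : x = 0 := by omega
    subst this
    rw [chainSum, if_neg (by omega)]

lemma Zhom_eq_green (K : ℕ → ℝ) (u : ℝ) (N : ℕ) :
    Zhom K u N = green (jumpW K (fun _ => u) ∅) 0 N := by
  unfold Zhom
  by_cases hN : N = 0
  · subst hN; simp [green_self]
  · rw [if_neg hN, ← sum_Icc_eq_green _ N (by omega)]
    apply Finset.sum_congr rfl
    intro k _
    rw [← sum_eq_chainSum K (fun _ => u) ∅ N N (by simp) k 0 (by omega)]
    apply Finset.sum_congr rfl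
    intro s _
    simp [adm]

lemma Zc_eq_green (K : ℕ → ℝ) (β h : ℝ) (ω : ℕ → ℝ) (N : ℕ) (hN : 1 ≤ N) :
    Zc K β h ω N =
      green (jumpW K (fun n => β * ω n + h) ((changeSet ω N).image (fun m => m - 1))) 0 N := by
  unfold Zc
  rw [← sum_Icc_eq_green _ N (by omega)]
  apply Finset.sum_congr rfl
  intro k _
  rw [← sum_eq_chainSum K _ _ N N _ k 0 (by omega)]
  · apply Finset.sum_congr rfl
    intro s _
    have : adm ((changeSet ω N).image (fun m => m - 1)) N N k 0 s ↔
        ((∀ i, 1 ≤ (s i : ℕ)) ∧ (∑ i, (s i : ℕ)) = N ∧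
        (∀ m ∈ changeSet ω N, ∃ i : Fin k, contacts s i = m - 1)) := by
      unfold adm
      simp only [zero_add, Finset.forall_mem_image]
      refine and_congr_right fun _ => and_congr_right fun _ => ?_
      refine forall₂_congr fun m hm => ?_
      have : 0 < m - 1 := by
        simp only [changeSet, Finset.mem_filter, Finset.mem_Icc] at hm
        omega
      simp [this]
    simp only [this, zero_add]
  · intro c hc
    simp only [changeSet, Finset.mem_image, Finset.mem_filter, Finset.mem_Icc] at hc
    obtain ⟨m, hm, rfl⟩ := hc
    omega

lemma strip_green (K : ℕ → ℝ) (β h : ℝ) (ω : ℕ → ℝ) (N a b : ℕ) (hab : a ≤ b) (hbN : b ≤ N)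
    (hno : ∀ m ∈ changeSet ω N, a + 1 < m → b + 1 ≤ m) :
    green (jumpW K (fun n => β * ω n + h) ((changeSet ω N).image (fun m => m - 1))) a b =
      Zhom K (β * ω (a + 1) + h) (b - a) := by
  have hconst : ∀ y, a + (y + 1) ≤ b → ω (a + (y + 1)) = ω (a + 1) := by
    intro y
    induction y with
    | zero => intro _; rfl
    | succ y ih =>
      intro hy
      rw [← ih (by omega)]
      by_contra hne
      have := hno (a + (y + 1 + 1)) (by
        simp only [changeSet, Finset.mem_filter, Finset.mem_Icc]
        exact ⟨by omega, hne⟩) (by omega)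
      omega
  rw [Zhom_eq_green]
  obtain ⟨n, rfl⟩ := Nat.exists_eq_add_of_le hab
  unfold green
  simp only [Nat.add_sub_cancel_left, Nat.sub_zero]
  apply Finset.sum_congr rfl
  intro k _
  apply chainSum_shift _ _ a n _ k 0
  intro x y hxy hyn
  unfold jumpW
  rw [if_neg, if_neg]
  · obtain ⟨z, rfl⟩ : ∃ z, y = z + 1 := ⟨y - 1, by omega⟩
    beta_reduce
    rw [hconst z (by omega)]
    congr 2
    omega
  · simp
  · rintro ⟨c, hc, h1, h2⟩
    obtain ⟨m, hm, rfl⟩ := Finset.mem_image.1 hc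
    have := hno m hm (by omega)
    omega

lemma Lstrip_succ (ω : ℕ → ℝ) (N k : ℕ) (hk : k < BN ω N) :
    Lstrip ω N (k + 1) = (changeSet ω N).orderEmbOfFin rfl ⟨k, hk⟩ - 1 := by
  have hlen : k < ((changeSet ω N).sort (· ≤ ·)).length := by
    rw [Finset.length_sort]; exact hk
  unfold Lstrip
  rw [if_neg (by omega), Finset.orderEmbOfFin_apply, Nat.add_sub_cancel,
    List.getD_eq_getElem _ _ hlen]
  rfl

lemma changeSet_index (ω : ℕ → ℝ) (N m : ℕ) (hm : m ∈ changeSet ω N) :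
    ∃ k, k < BN ω N ∧ m = Lstrip ω N (k + 1) + 1 := by
  have : m ∈ Set.range ((changeSet ω N).orderEmbOfFin rfl) := by
    rw [Finset.range_orderEmbOfFin]; exact hm
  obtain ⟨⟨k, hk⟩, rfl⟩ := this
  refine ⟨k, hk, ?_⟩
  rw [Lstrip_succ ω N k hk]
  simp only [changeSet, Finset.mem_filter, Finset.mem_Icc] at hm
  unfold changeSet
  omega

lemma Lstrip_mem (ω : ℕ → ℝ) (N k : ℕ) (hk : k < BN ω N) :
    Lstrip ω N (k + 1) + 1 ∈ changeSet ω N := by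
  have hm := (changeSet ω N).orderEmbOfFin_mem rfl ⟨k, hk⟩
  have h2 : 2 ≤ (changeSet ω N).orderEmbOfFin rfl ⟨k, hk⟩ := by
    exact (Finset.mem_Icc.1 (Finset.mem_filter.1 hm).1).1
  rw [Lstrip_succ ω N k hk, Nat.sub_add_cancel (by omega)]
  exact hm

lemma Lstrip_bounds (ω : ℕ → ℝ) (N k : ℕ) (hk : k < BN ω N) :
    1 ≤ Lstrip ω N (k + 1) ∧ Lstrip ω N (k + 1) ≤ N := by
  have := Lstrip_mem ω N k hk
  simp only [changeSet, Finset.mem_filter, Finset.mem_Icc] at this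
  omega

lemma Lstrip_lt (ω : ℕ → ℝ) (N j k : ℕ) (hk : k ≤ BN ω N) (hjk : j < k) :
    Lstrip ω N j < Lstrip ω N k := by
  obtain ⟨k, rfl⟩ : ∃ z, k = z + 1 := ⟨k - 1, by omega⟩
  have hb := Lstrip_bounds ω N k (by omega)
  cases j with
  | zero =>
    have : Lstrip ω N 0 = 0 := by simp [Lstrip]
    omega
  | succ j =>
    have hb' := Lstrip_bounds ω N j (by omega)
    rw [Lstrip_succ ω N k (by omega)] at *
    rw [Lstrip_succ ω N j (by omega)] at *
    have : (changeSet ω N).orderEmbOfFin rfl ⟨j, by unfold BN at hk; omega⟩ <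
      (changeSet ω N).orderEmbOfFin rfl ⟨k, by unfold BN at hk; omega⟩ :=
      ((changeSet ω N).orderEmbOfFin rfl).strictMono (by simp; omega)
    omega

/-- The constrained partition function factorizes over the
strips: `Z^c_{N,β,h,ω} = (∏_{i=1}^{B_N} Z_{l_i, β ω_{L_{i-1}+1} + h}) ·
Z_{N - L_{B_N}, β ω_{L_{B_N}+1} + h}`, with `l_i = L_i - L_{i-1}` and the
convention `Z_{0,u} = 1`. -/
theorem statement13 (K : ℕ → ℝ) (hKpos : ∀ n, 1 ≤ n → 0 < K n)
    (hKsum : ∑' n : ℕ, K (n + 1) = 1)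
    (β h : ℝ) (hβ : 0 ≤ β)
    (ω : ℕ → ℝ) (hω : ∀ n, ω n = 1 ∨ ω n = -1)
    (N : ℕ) (hN : 1 ≤ N) :
    Zc K β h ω N =
      (∏ i ∈ Finset.Icc 1 (BN ω N),
        Zhom K (β * ω (Lstrip ω N (i - 1) + 1) + h) (Lstrip ω N i - Lstrip ω N (i - 1))) *
      Zhom K (β * ω (Lstrip ω N (BN ω N) + 1) + h) (N - Lstrip ω N (BN ω N)) := by
  rw [Zc_eq_green K β h ω N hN]
  have h0 : Lstrip ω N 0 = 0 := by simp [Lstrip]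
  have hle : ∀ n, n ≤ BN ω N → Lstrip ω N n ≤ N := by
    intro n hn
    cases n with
    | zero => omega
    | succ n => exact (Lstrip_bounds ω N n (by omega)).2
  rw [← strip_green K β h ω N _ N (hle _ le_rfl) le_rfl]
  · have main : ∀ n, n ≤ BN ω N →
        green (jumpW K (fun n => β * ω n + h) ((changeSet ω N).image (fun m => m - 1))) 0 N =
        (∏ i ∈ Finset.Icc 1 n,
          Zhom K (β * ω (Lstrip ω N (i - 1) + 1) + h) (Lstrip ω N i - Lstrip ω N (i - 1))) *
        green (jumpW K (fun n => β * ω n + h) ((changeSet ω N).image (fun m => m - 1)))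
          (Lstrip ω N n) N := by
      intro n
      induction n with
      | zero => intro _; simp [h0]
      | succ n ih =>
        intro hn
        have hlt := Lstrip_lt ω N n (n + 1) hn (by omega)
        rw [ih (by omega), Finset.prod_Icc_succ_top (by omega), mul_assoc]
        congr 1
        rw [green_factor _ (Lstrip ω N (n + 1)) N (hle _ hn) _ _ _ rfl hlt.le]
        · congr 1
          rw [Nat.add_sub_cancel]
          apply strip_green K β h ω N _ _ hlt.le (hle _ hn)
          intro m hm hlm
          obtain ⟨j, hj, rfl⟩ := changeSet_index ω N m hm
          by_contra hcon
          have h1 : n < j + 1 := by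
            by_contra hc
            rcases Nat.eq_or_lt_of_le (Nat.le_of_not_lt hc) with e | e
            · rw [e] at hlm; omega
            · have := Lstrip_lt ω N (j + 1) n (by omega) e
              omega
          rcases Nat.eq_or_lt_of_le (Nat.succ_le_of_lt h1) with e | e
          · rw [← e] at hcon; simp at hcon
          · have := Lstrip_lt ω N (n + 1) (j + 1) (by omega) e
            omega
        · intro x y hx hy
          unfold jumpW
          rw [if_pos]
          exact ⟨Lstrip ω N (n + 1), Finset.mem_image.2
            ⟨_, Lstrip_mem ω N n (by omega), by omega⟩, hx, hy⟩
    exact main _ le_rfl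
  · intro m hm hlm
    obtain ⟨j, hj, rfl⟩ := changeSet_index ω N m hm
    exfalso
    rcases Nat.eq_or_lt_of_le (Nat.succ_le_of_lt hj) with e | e
    · rw [← e] at hlm; simp at hlm
    · have := Lstrip_lt ω N (j + 1) (BN ω N) le_rfl e
      omega
end
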